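/- Let Φ be a unital positive linear map on B(H), let 0 ≤ r ≤ 1/2, and let f, g : (0,∞) → (0,∞) be operator convex functions such that the function t ↦ f(t)g(t)/t is operator concave. Then for every positive invertible operator A ∈ B(H) there exists a partial isometry V such that |Φ(f(A))^{-r} Φ(A)^r Φ(g(A))^{-r}| ≤ V* Φ(f(A)^{-r} A^r g(A)^{-r}) V. -/

import Mathlib

open scoped NNReal

variable {H : Type*} [NormedAddCommGroup H] [InnerProductSpace ℂ H] [CompleteSpace H]

/-- The absolute value `|X| = (X*X)^(1/2)` of a bounded operator `X` on a Hilbert space. -/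
noncomputable def opAbs (X : H →L[ℂ] H) : H →L[ℂ] H := CFC.sqrt (star X * X)

/-- `Φ` is a unital positive linear map on `B(H)`: `Φ(I) = I` and `Φ(X) ≥ 0` whenever `X ≥ 0`
(with respect to the Löwner order). -/
def IsUnitalPositiveMap (Φ : (H →L[ℂ] H) →ₗ[ℂ] (H →L[ℂ] H)) : Prop :=
  Φ 1 = 1 ∧ ∀ X : H →L[ℂ] H, 0 ≤ X → 0 ≤ Φ X

/-- `f : (0,∞) → (0,∞)` is operator convex: for all positive invertible operators `A, B` on `H`
and all `c ∈ [0,1]`, `f(cA + (1-c)B) ≤ c f(A) + (1-c) f(B)` in the Löwner order, where `f(A)` is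
given by the continuous functional calculus. -/
def IsOperatorConvexOn (H : Type*) [NormedAddCommGroup H] [InnerProductSpace ℂ H]
    [CompleteSpace H] (f : ℝ → ℝ) : Prop :=
  ∀ (A B : H →L[ℂ] H), 0 ≤ A → IsUnit A → 0 ≤ B → IsUnit B →
    ∀ c : ℝ, c ∈ Set.Icc (0 : ℝ) 1 →
      cfc f (c • A + (1 - c) • B) ≤ c • cfc f A + (1 - c) • cfc f B

/-- `f : (0,∞) → (0,∞)` is operator concave if `-f` is operator convex. -/
def IsOperatorConcaveOn (H : Type*) [NormedAddCommGroup H] [InnerProductSpace ℂ H]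
    [CompleteSpace H] (f : ℝ → ℝ) : Prop :=
  IsOperatorConvexOn H (fun t => -(f t))

open scoped InnerProductSpace

universe u

section FunctionalCalculus

open ContinuousLinearMap

variable {E F : Type*} [NormedAddCommGroup E] [InnerProductSpace ℂ E] [CompleteSpace E]
  [NormedAddCommGroup F] [InnerProductSpace ℂ F] [CompleteSpace F]

/-- The two-sided operator bound `a I ≤ A ≤ b I`. -/
def OpBetween (a b : ℝ) (A : E →L[ℂ] E) : Prop :=
  algebraMap ℝ (E →L[ℂ] E) a ≤ A ∧ A ≤ algebraMap ℝ (E →L[ℂ] E) b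

lemma OpBetween.isSelfAdjoint {a b : ℝ} {A : E →L[ℂ] E} (h : OpBetween a b A) :
    IsSelfAdjoint A := by
  have h1 : IsSelfAdjoint (A - algebraMap ℝ (E →L[ℂ] E) a) :=
    IsSelfAdjoint.of_nonneg (sub_nonneg.2 h.1)
  have h2 : IsSelfAdjoint (algebraMap ℝ (E →L[ℂ] E) a) := IsSelfAdjoint.algebraMap _ (.all a)
  simpa using h1.add h2

lemma OpBetween.spectrum_subset {a b : ℝ} {A : E →L[ℂ] E} (h : OpBetween a b A) :
    spectrum ℝ A ⊆ Set.Icc a b := fun x hx =>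
  ⟨(algebraMap_le_iff_le_spectrum h.isSelfAdjoint).1 h.1 x hx,
    (le_algebraMap_iff_spectrum_le h.isSelfAdjoint).1 h.2 x hx⟩

lemma opBetween_of_spectrum_subset {a b : ℝ} {A : E →L[ℂ] E} (hA : IsSelfAdjoint A)
    (h : spectrum ℝ A ⊆ Set.Icc a b) : OpBetween a b A :=
  ⟨(algebraMap_le_iff_le_spectrum hA).2 fun _ hx => (h hx).1,
    (le_algebraMap_iff_spectrum_le hA).2 fun _ hx => (h hx).2⟩

lemma OpBetween.mono {a b a' b' : ℝ} {A : E →L[ℂ] E} (h : OpBetween a b A) (ha : a' ≤ a)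
    (hb : b ≤ b') : OpBetween a' b' A :=
  opBetween_of_spectrum_subset h.isSelfAdjoint
    (h.spectrum_subset.trans (Set.Icc_subset_Icc ha hb))

lemma OpBetween.nonneg {a b : ℝ} {A : E →L[ℂ] E} (h : OpBetween a b A) (ha : 0 < a) : 0 ≤ A :=
  (algebraMap_nonneg _ ha.le).trans h.1

lemma OpBetween.isUnit {a b : ℝ} {A : E →L[ℂ] E} (h : OpBetween a b A) (ha : 0 < a) :
    IsUnit A :=
  spectrum.isUnit_of_zero_notMem ℝ fun h0 => absurd (h.spectrum_subset h0).1 (not_le.2 ha)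

lemma exists_opBetween {A : E →L[ℂ] E} (hA : 0 ≤ A) (hAu : IsUnit A) :
    ∃ a b : ℝ, 0 < a ∧ OpBetween a b A := by
  have hsa : IsSelfAdjoint A := .of_nonneg hA
  have hc : IsCompact (spectrum ℝ A) := ContinuousFunctionalCalculus.isCompact_spectrum A
  obtain hem | hne := (spectrum ℝ A).eq_empty_or_nonempty
  · exact ⟨1, 1, one_pos, opBetween_of_spectrum_subset hsa (by simp [hem])⟩
  · refine ⟨sInf (spectrum ℝ A), sSup (spectrum ℝ A), ?_, opBetween_of_spectrum_subset hsa
      fun x hx => ⟨csInf_le hc.bddBelow hx, le_csSup hc.bddAbove hx⟩⟩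
    have hm := hc.sInf_mem hne
    refine lt_of_le_of_ne (spectrum_nonneg_of_nonneg hA hm) fun h0 => ?_
    rw [← h0] at hm
    exact spectrum.zero_notMem ℝ hAu hm

lemma algebraMap_real_apply {E : Type*} [NormedAddCommGroup E] [InnerProductSpace ℂ E] (a : ℝ)
    (x : E) : algebraMap ℝ (E →L[ℂ] E) a x = (a : ℂ) • x := by
  simp [Algebra.algebraMap_eq_smul_one]

lemma opLE_iff {A B : E →L[ℂ] E} (hA : IsSelfAdjoint A) (hB : IsSelfAdjoint B) :
    A ≤ B ↔ ∀ x, RCLike.re ⟪A x, x⟫_ℂ ≤ RCLike.re ⟪B x, x⟫_ℂ := by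
  rw [le_def, isPositive_def']
  simp [hB.sub hA, reApplyInnerSelf, inner_sub_left]

/-- The compression `V* A V`. -/
noncomputable def compress (V : E →L[ℂ] F) (A : F →L[ℂ] F) : E →L[ℂ] E :=
  adjoint V ∘L A ∘L V

lemma inner_compress (V : E →L[ℂ] F) (A : F →L[ℂ] F) (x y : E) :
    ⟪compress V A x, y⟫_ℂ = ⟪A (V x), V y⟫_ℂ := by
  simp [compress, adjoint_inner_left]

lemma compress_mono (V : E →L[ℂ] F) {A B : F →L[ℂ] F} (h : A ≤ B) :
    compress V A ≤ compress V B := by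
  rw [le_def] at h ⊢
  convert h.adjoint_conj V using 1
  ext x
  simp [compress]

lemma isSelfAdjoint_compress (V : E →L[ℂ] F) {A : F →L[ℂ] F} (h : IsSelfAdjoint A) :
    IsSelfAdjoint (compress V A) := h.adjoint_conj V

lemma compress_algebraMap {V : E →L[ℂ] F} (hV : adjoint V ∘L V = .id ℂ E) (a : ℝ) :
    compress V (algebraMap ℝ _ a) = algebraMap ℝ _ a := by
  ext x
  have := DFunLike.congr_fun hV x
  simp only [comp_apply, id_apply] at this
  simp [compress, this]

lemma OpBetween.compress {a b : ℝ} {A : F →L[ℂ] F} (h : OpBetween a b A) {V : E →L[ℂ] F}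
    (hV : adjoint V ∘L V = .id ℂ E) : OpBetween a b (compress V A) :=
  ⟨compress_algebraMap hV a ▸ compress_mono V h.1, compress_algebraMap hV b ▸ compress_mono V h.2⟩

lemma norm_aeval_sub_cfc_le {a b : ℝ} {f : ℝ → ℝ} (hf : ContinuousOn f (Set.Icc a b)) {ε : ℝ}
    {p : Polynomial ℝ} (hp : ∀ x ∈ Set.Icc a b, |p.eval x - f x| < ε) (hε : 0 < ε)
    {A : E →L[ℂ] E} (hA : OpBetween a b A) : ‖p.aeval A - cfc f A‖ ≤ ε := by
  have hsa := hA.isSelfAdjoint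
  rw [← cfc_polynomial p A, ← cfc_sub (fun x => p.eval x) f A (by fun_prop)
    (hf.mono hA.spectrum_subset)]
  exact norm_cfc_le hε.le fun x hx => (hp x (hA.spectrum_subset hx)).le

lemma aeval_comp_of_intertwine {E F : Type*} [NormedAddCommGroup E] [InnerProductSpace ℂ E]
    [NormedAddCommGroup F] [InnerProductSpace ℂ F] {A : F →L[ℂ] F} {B : E →L[ℂ] E} {V : E →L[ℂ] F}
    (h : A ∘L V = V ∘L B) (p : Polynomial ℝ) : p.aeval A ∘L V = V ∘L p.aeval B := by
  have h' : ∀ x, A (V x) = V (B x) := fun x => DFunLike.congr_fun h x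
  ext x
  induction p using Polynomial.induction_on' with
  | add p q hp hq => simpa using congrArg₂ (· + ·) hp hq
  | monomial n c =>
    have : ∀ x, (A ^ n) (V x) = V ((B ^ n) x) := by
      induction n with
      | zero => simp
      | succ n ih => intro x; simp [pow_succ, h', ih]
    simp [Polynomial.aeval_monomial, this]

/-- The functional calculus respects intertwining operators. -/
lemma cfc_comp_of_intertwine {a b : ℝ} {f : ℝ → ℝ} (hf : ContinuousOn f (Set.Icc a b))
    {A : F →L[ℂ] F} {B : E →L[ℂ] E} (hA : OpBetween a b A) (hB : OpBetween a b B)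
    {V : E →L[ℂ] F} (h : A ∘L V = V ∘L B) : cfc f A ∘L V = V ∘L cfc f B := by
  rw [← sub_eq_zero, ← norm_le_zero_iff]
  refine le_of_forall_pos_le_add fun ε hε => ?_
  obtain ⟨p, hp⟩ := exists_polynomial_near_of_continuousOn a b f hf (ε / (2 * ‖V‖ + 1))
    (by positivity)
  have h1 := norm_aeval_sub_cfc_le hf hp (by positivity) hA
  have h2 := norm_aeval_sub_cfc_le hf hp (by positivity) hB
  have key : cfc f A ∘L V - V ∘L cfc f B =
      V ∘L (p.aeval B - cfc f B) - (p.aeval A - cfc f A) ∘L V := by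
    rw [comp_sub, sub_comp, aeval_comp_of_intertwine h]; abel
  rw [key]
  calc _ ≤ ‖V‖ * (ε / (2 * ‖V‖ + 1)) + (ε / (2 * ‖V‖ + 1)) * ‖V‖ := by
        refine (norm_sub_le _ _).trans (add_le_add ?_ ?_)
        · exact (opNorm_comp_le _ _).trans (by gcongr)
        · exact (opNorm_comp_le _ _).trans (by gcongr)
    _ = ε * (2 * ‖V‖ / (2 * ‖V‖ + 1)) := by ring
    _ ≤ ε * 1 := by
        gcongr
        rw [div_le_one (by positivity)]; linarith
    _ = 0 + ε := by ring

end FunctionalCalculus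

section Isometries

open ContinuousLinearMap

variable {E F : Type*} [NormedAddCommGroup E] [InnerProductSpace ℂ E] [CompleteSpace E]
  [NormedAddCommGroup F] [InnerProductSpace ℂ F] [CompleteSpace F]

lemma adjoint_apply_apply_of_isometry {V : E →L[ℂ] F} (hV : adjoint V ∘L V = .id ℂ E) (x : E) :
    adjoint V (V x) = x := DFunLike.congr_fun hV x

lemma inner_map_map_of_isometry {V : E →L[ℂ] F} (hV : adjoint V ∘L V = .id ℂ E) (x y : E) :
    ⟪V x, V y⟫_ℂ = ⟪x, y⟫_ℂ := by
  rw [← adjoint_inner_left, adjoint_apply_apply_of_isometry hV]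

lemma compress_cfc_of_intertwine {a b : ℝ} {f : ℝ → ℝ} (hf : ContinuousOn f (Set.Icc a b))
    {A : F →L[ℂ] F} {B : E →L[ℂ] E} (hA : OpBetween a b A) (hB : OpBetween a b B)
    {V : E →L[ℂ] F} (hV : adjoint V ∘L V = .id ℂ E) (h : A ∘L V = V ∘L B) :
    compress V (cfc f A) = cfc f B := by
  rw [compress, cfc_comp_of_intertwine hf hA hB h, ← comp_assoc, hV, id_comp]

lemma isSelfAdjoint_cfc_real (f : ℝ → ℝ) (A : E →L[ℂ] E) : IsSelfAdjoint (cfc f A) :=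
  cfc_predicate f A

/-- The extension of an operator along an isometry which is the identity on the orthogonal
complement of the range. -/
noncomputable def extendByOne (V : E →L[ℂ] F) (A : E →L[ℂ] E) : F →L[ℂ] F :=
  V ∘L A ∘L adjoint V + (1 - V ∘L adjoint V)

lemma extendByOne_comp {V : E →L[ℂ] F} (hV : adjoint V ∘L V = .id ℂ E) (A : E →L[ℂ] E) :
    extendByOne V A ∘L V = V ∘L A := by
  ext x
  simp [extendByOne, adjoint_apply_apply_of_isometry hV]

lemma norm_adjoint_apply_le_of_isometry {V : E →L[ℂ] F} (hV : adjoint V ∘L V = .id ℂ E) (x : F) :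
    ‖adjoint V x‖ ≤ ‖x‖ := by
  have h1 : ‖V (adjoint V x)‖ = ‖adjoint V x‖ := by
    have := inner_map_map_of_isometry hV (adjoint V x) (adjoint V x)
    rw [inner_self_eq_norm_sq_to_K, inner_self_eq_norm_sq_to_K] at this
    exact (sq_eq_sq₀ (norm_nonneg _) (norm_nonneg _)).1 (by exact_mod_cast this)
  have h2 : ‖adjoint V x‖ ^ 2 ≤ ‖adjoint V x‖ * ‖x‖ := by
    have h := re_inner_le_norm (𝕜 := ℂ) (V (adjoint V x)) x
    rw [← adjoint_inner_right, inner_self_eq_norm_sq (𝕜 := ℂ), h1] at h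
    exact h
  by_contra! hlt
  nlinarith [norm_nonneg x, norm_nonneg (adjoint V x)]

lemma opBetween_iff {a b : ℝ} {A : E →L[ℂ] E} (hA : IsSelfAdjoint A) :
    OpBetween a b A ↔ ∀ x, a * ‖x‖ ^ 2 ≤ RCLike.re ⟪A x, x⟫_ℂ ∧
      RCLike.re ⟪A x, x⟫_ℂ ≤ b * ‖x‖ ^ 2 := by
  have h : ∀ (c : ℝ) (x : E), RCLike.re ⟪algebraMap ℝ (E →L[ℂ] E) c x, x⟫_ℂ = c * ‖x‖ ^ 2 := by
    intro c x
    rw [algebraMap_real_apply, inner_smul_left, inner_self_eq_norm_sq_to_K]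
    norm_cast
    simp only [Complex.coe_algebraMap, Complex.conj_ofReal]
    norm_cast
  rw [OpBetween, opLE_iff (IsSelfAdjoint.algebraMap _ (.all a)) hA,
    opLE_iff hA (IsSelfAdjoint.algebraMap _ (.all b))]
  simp only [h, forall_and]

lemma OpBetween.convexComb {a b : ℝ} {A B : E →L[ℂ] E} (hA : OpBetween a b A)
    (hB : OpBetween a b B) {c : ℝ} (hc : c ∈ Set.Icc (0 : ℝ) 1) :
    OpBetween a b (c • A + (1 - c) • B) := by
  have h1 := (opBetween_iff hA.isSelfAdjoint).1 hA
  have h2 := (opBetween_iff hB.isSelfAdjoint).1 hB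
  rw [opBetween_iff (((IsSelfAdjoint.all c).smul hA.isSelfAdjoint).add
    ((IsSelfAdjoint.all _).smul hB.isSelfAdjoint))]
  intro x
  have h3 : RCLike.re ⟪(c • A + (1 - c) • B) x, x⟫_ℂ =
      c * RCLike.re ⟪A x, x⟫_ℂ + (1 - c) * RCLike.re ⟪B x, x⟫_ℂ := by
    simp only [add_apply, smul_apply, inner_add_left, inner_smul_left_eq_smul, map_add,
      RCLike.smul_re]
  rw [h3]
  obtain ⟨hc0, hc1⟩ := hc
  constructor <;> nlinarith [h1 x, h2 x]

lemma OpBetween.extendByOne {a b : ℝ} {A : E →L[ℂ] E} (h : OpBetween a b A) {V : E →L[ℂ] F}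
    (hV : adjoint V ∘L V = .id ℂ E) : OpBetween (min a 1) (max b 1) (extendByOne V A) := by
  have hsa : IsSelfAdjoint (_root_.extendByOne V A) := by
    refine ((h.isSelfAdjoint.conj_adjoint V)).add ((IsSelfAdjoint.one _).sub ?_)
    rw [isSelfAdjoint_iff', adjoint_comp, adjoint_adjoint]
  rw [opBetween_iff hsa]
  intro x
  have h1 := (opBetween_iff h.isSelfAdjoint).1 h (adjoint V x)
  have h2 := norm_adjoint_apply_le_of_isometry hV x
  have h3 : ‖adjoint V x‖ ^ 2 ≤ ‖x‖ ^ 2 := by gcongr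
  have key : RCLike.re ⟪_root_.extendByOne V A x, x⟫_ℂ =
      RCLike.re ⟪A (adjoint V x), adjoint V x⟫_ℂ + (‖x‖ ^ 2 - ‖adjoint V x‖ ^ 2) := by
    rw [← inner_self_eq_norm_sq (𝕜 := ℂ) x, ← inner_self_eq_norm_sq (𝕜 := ℂ) (adjoint V x)]
    simp only [_root_.extendByOne, add_apply, sub_apply, comp_apply, one_apply_eq_self,
      inner_add_left, inner_sub_left, adjoint_inner_right, map_add, map_sub]
  rw [key]
  have h4 := sq_nonneg ‖adjoint V x‖
  have h5 := min_le_left a 1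
  have h6 := min_le_right a 1
  have h7 := le_max_left b 1
  have h8 := le_max_right b 1
  constructor <;> nlinarith

/-- Operator convexity passes to Hilbert spaces which embed isometrically. -/
lemma IsOperatorConvexOn.of_isometry {f : ℝ → ℝ} (hfc : ContinuousOn f (Set.Ioi 0))
    (hf : IsOperatorConvexOn F f) {V : E →L[ℂ] F} (hV : adjoint V ∘L V = .id ℂ E) :
    IsOperatorConvexOn E f := by
  intro A B hA hAu hB hBu c hc
  obtain ⟨a, b, ha, hab⟩ := exists_opBetween hA hAu
  obtain ⟨a', b', ha', hab'⟩ := exists_opBetween hB hBu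
  have hA' := hab.extendByOne hV
  have hB' := hab'.extendByOne hV
  have hmin : 0 < min a 1 := lt_min ha one_pos
  have hmin' : 0 < min a' 1 := lt_min ha' one_pos
  have key := hf _ _ (hA'.nonneg hmin) (hA'.isUnit hmin) (hB'.nonneg hmin') (hB'.isUnit hmin') c hc
  have hcomb : c • extendByOne V A + (1 - c) • extendByOne V B =
      extendByOne V (c • A + (1 - c) • B) := by
    ext x
    simp only [extendByOne, add_apply, smul_apply, comp_apply, sub_apply, one_apply_eq_self,
      map_add]
    rw [V.map_smul_of_tower, V.map_smul_of_tower]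
    module
  have hC : OpBetween (min a a') (max b b') (c • A + (1 - c) • B) :=
    (hab.mono (min_le_left _ _) (le_max_left _ _)).convexComb
      (hab'.mono (min_le_right _ _) (le_max_right _ _)) hc
  have hmin'' : 0 < min a a' := lt_min ha ha'
  have hcont : ∀ {s t : ℝ}, 0 < s → ContinuousOn f (Set.Icc s t) := fun hs =>
    hfc.mono fun x hx => lt_of_lt_of_le hs hx.1
  have hcomp : ∀ {s t : ℝ} {D : E →L[ℂ] E}, 0 < s → OpBetween s t D →
      compress V (cfc f (extendByOne V D)) = cfc f D := fun {s t D} hs hD =>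
    compress_cfc_of_intertwine (hcont (lt_min hs one_pos)) (hD.extendByOne hV)
      (hD.mono (min_le_left _ _) (le_max_left _ _)) hV (extendByOne_comp hV D)
  rw [hcomb] at key
  have key' := compress_mono V key
  rw [hcomp hmin'' hC] at key'
  refine key'.trans (le_of_eq ?_)
  rw [← hcomp ha hab, ← hcomp ha' hab']
  ext x
  simp only [compress, comp_apply, add_apply, smul_apply, map_add]
  rw [(adjoint V).map_smul_of_tower, (adjoint V).map_smul_of_tower]

/-- Jensen's inequality for compressions, when the function is operator convex on the larger
space. -/
lemma IsOperatorConvexOn.cfc_compress_le {f : ℝ → ℝ} (hf : IsOperatorConvexOn F f) {a b : ℝ}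
    (hfc : ContinuousOn f (Set.Icc a b)) (ha : 0 < a) {A : F →L[ℂ] F} (hA : OpBetween a b A)
    {V : E →L[ℂ] F} (hV : adjoint V ∘L V = .id ℂ E) :
    cfc f (compress V A) ≤ compress V (cfc f A) := by
  set U : F →L[ℂ] F := V ∘L adjoint V + V ∘L adjoint V - 1 with hU
  have hVx := adjoint_apply_apply_of_isometry hV
  have hUad : adjoint U = U := by
    have h1 : IsSelfAdjoint (V ∘L adjoint V) := by
      rw [isSelfAdjoint_iff', adjoint_comp, adjoint_adjoint]
    exact ((h1.add h1).sub (IsSelfAdjoint.one (F →L[ℂ] F))).adjoint_eq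
  have hUU : ∀ x, U (U x) = x := by
    intro x
    simp only [hU, sub_apply, add_apply, comp_apply, one_apply_eq_self, map_sub, map_add, hVx]
    module
  have hUiso : adjoint U ∘L U = .id ℂ F := by
    rw [hUad]; ext x; exact hUU x
  have hUV : ∀ x, U (V x) = V x := by
    intro x
    simp only [hU, sub_apply, add_apply, comp_apply, one_apply_eq_self, hVx]
    module
  have hVU : ∀ x, adjoint V (U x) = adjoint V x := by
    intro x
    simp only [hU, sub_apply, add_apply, comp_apply, one_apply_eq_self, hVx, map_sub, map_add]
    module
  have hA2 : OpBetween a b (compress U A) := hA.compress hUiso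
  have key := compress_mono V (hf A (compress U A) (hA.nonneg ha) (hA.isUnit ha) (hA2.nonneg ha)
    (hA2.isUnit ha) (1 / 2) ⟨by norm_num, by norm_num⟩)
  have hmean : OpBetween a b ((1 / 2 : ℝ) • A + (1 - 1 / 2 : ℝ) • compress U A) :=
    hA.convexComb hA2 ⟨by norm_num, by norm_num⟩
  have hint : ((1 / 2 : ℝ) • A + (1 - 1 / 2 : ℝ) • compress U A) ∘L V = V ∘L compress V A := by
    ext x
    simp only [comp_apply, add_apply, smul_apply, compress, hUad, hUV]
    simp only [hU, sub_apply, add_apply, comp_apply, one_apply_eq_self]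
    module
  rw [compress_cfc_of_intertwine hfc hmean (hA.compress hV) hV hint] at key
  have hint2 : cfc f (compress U A) ∘L U = U ∘L cfc f A :=
    cfc_comp_of_intertwine hfc hA2 hA (by
      ext x
      simp [compress, hUad, hUU])
  refine key.trans (le_of_eq ?_)
  ext x
  have h4 : cfc f (compress U A) (V x) = U (cfc f A (V x)) := by
    rw [← hUV x]
    conv_rhs => rw [hUV x]
    exact (DFunLike.congr_fun hint2 (V x))
  simp only [compress, comp_apply, add_apply, smul_apply, map_add] at h4 ⊢
  rw [h4, (adjoint V).map_smul_of_tower, (adjoint V).map_smul_of_tower, hVU]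
  module

end Isometries

section Glue

open ContinuousLinearMap

variable {E F : Type*} [NormedAddCommGroup E] [InnerProductSpace ℂ E] [CompleteSpace E]
  [NormedAddCommGroup F] [InnerProductSpace ℂ F] [CompleteSpace F]

lemma adjoint_subtypeL_comp_subtypeL (L : Submodule ℂ E) [CompleteSpace L] :
    adjoint L.subtypeL ∘L L.subtypeL = .id ℂ L := by
  refine ContinuousLinearMap.ext fun x => ext_inner_right ℂ fun y => ?_
  simp [adjoint_inner_left]

lemma subtypeL_adjoint_apply_of_mem (L : Submodule ℂ E) [CompleteSpace L] {x : E} (hx : x ∈ L) :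
    L.subtypeL (adjoint L.subtypeL x) = x := by
  have := adjoint_apply_apply_of_isometry (adjoint_subtypeL_comp_subtypeL L) ⟨x, hx⟩
  exact congrArg L.subtypeL this

lemma comp_subtypeL_eq_of_invariant (L : Submodule ℂ E) [CompleteSpace L] {A : E →L[ℂ] E}
    (h : ∀ x ∈ L, A x ∈ L) : A ∘L L.subtypeL = L.subtypeL ∘L compress L.subtypeL A := by
  ext x
  exact (subtypeL_adjoint_apply_of_mem L (h x x.2)).symm

lemma IsSelfAdjoint.inner_apply_left {A : E →L[ℂ] E} (hA : IsSelfAdjoint A) (x y : E) :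
    ⟪A x, y⟫_ℂ = ⟪x, A y⟫_ℂ := by
  rw [← adjoint_inner_left, hA.adjoint_eq]

lemma IsSelfAdjoint.mem_orthogonal_of_invariant {A : E →L[ℂ] E} (hA : IsSelfAdjoint A)
    {L : Submodule ℂ E} (h : ∀ x ∈ L, A x ∈ L) : ∀ x ∈ Lᗮ, A x ∈ Lᗮ := by
  intro x hx
  rw [Submodule.mem_orthogonal] at hx ⊢
  intro u hu
  rw [← hA.inner_apply_left]
  exact hx _ (h u hu)

/-- Jensen's inequality for a compression may be checked after splitting off a common invariant
subspace. -/
lemma cfc_compress_le_of_orthogonal {f : ℝ → ℝ} {a b : ℝ} (hfc : ContinuousOn f (Set.Icc a b))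
    {A : F →L[ℂ] F} (hA : OpBetween a b A) {V : E →L[ℂ] F} (hV : adjoint V ∘L V = .id ℂ E)
    (L : Submodule ℂ E) [FiniteDimensional ℂ L]
    (hL : ∀ x ∈ L, A (V x) ∈ L.map (V : E →ₗ[ℂ] F))
    (h : ∀ V' : Lᗮ →L[ℂ] (L.map (V : E →ₗ[ℂ] F))ᗮ, adjoint V' ∘L V' = .id ℂ Lᗮ →
      cfc f (compress V' (compress (L.map (V : E →ₗ[ℂ] F))ᗮ.subtypeL A)) ≤
        compress V' (cfc f (compress (L.map (V : E →ₗ[ℂ] F))ᗮ.subtypeL A))) :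
    cfc f (compress V A) ≤ compress V (cfc f A) := by
  have : CompleteSpace L := FiniteDimensional.complete ℂ L
  set M := (L.map (V : E →ₗ[ℂ] F))ᗮ with hM
  set B := compress V A with hBdef
  have hB : OpBetween a b B := hA.compress hV
  have hVx := adjoint_apply_apply_of_isometry hV
  have hVi := inner_map_map_of_isometry hV
  have hLB : ∀ x ∈ L, B x ∈ L ∧ A (V x) = V (B x) := by
    intro x hx
    obtain ⟨y, hy, hyx⟩ := hL x hx
    have hyx' : V y = A (V x) := hyx
    have : B x = y := by
      change adjoint V (A (V x)) = y
      rw [← hyx', hVx]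
    rw [this]
    exact ⟨hy, hyx'.symm⟩
  have hAM : ∀ x ∈ M, A x ∈ M := hA.isSelfAdjoint.mem_orthogonal_of_invariant (by
    rintro _ ⟨x, hx, rfl⟩
    exact hL x hx)
  have hBR : ∀ x ∈ Lᗮ, B x ∈ Lᗮ :=
    hB.isSelfAdjoint.mem_orthogonal_of_invariant fun x hx => (hLB x hx).1
  have hVR : ∀ x ∈ Lᗮ, V x ∈ M := by
    intro x hx
    rw [hM, Submodule.mem_orthogonal]
    rintro _ ⟨y, hy, rfl⟩
    exact (hVi y x).trans ((Submodule.mem_orthogonal _ _).1 hx y hy)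
  set R := Lᗮ.subtypeL with hR
  set S := M.subtypeL with hS
  have hRiso : adjoint R ∘L R = .id ℂ Lᗮ := adjoint_subtypeL_comp_subtypeL _
  have hSiso : adjoint S ∘L S = .id ℂ M := adjoint_subtypeL_comp_subtypeL _
  set V' : Lᗮ →L[ℂ] M := adjoint S ∘L V ∘L R with hV'
  have hSV : ∀ x : Lᗮ, S (V' x) = V (R x) := fun x =>
    subtypeL_adjoint_apply_of_mem M (hVR _ x.2)
  have hV'iso : adjoint V' ∘L V' = .id ℂ Lᗮ := by
    refine ContinuousLinearMap.ext fun x => ext_inner_right ℂ fun y => ?_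
    rw [comp_apply, adjoint_inner_left, id_apply, ← inner_map_map_of_isometry hSiso, hSV, hSV, hVi,
      inner_map_map_of_isometry hRiso]
  set A' := compress S A with hA'def
  have hA' : OpBetween a b A' := hA.compress hSiso
  have hAS : A ∘L S = S ∘L A' := comp_subtypeL_eq_of_invariant M hAM
  have hBR' : B ∘L R = R ∘L compress R B := comp_subtypeL_eq_of_invariant _ hBR
  have hcomp : compress R B = compress V' A' := by
    refine ContinuousLinearMap.ext fun x => ext_inner_right ℂ fun y => ?_
    rw [inner_compress, inner_compress, inner_compress, inner_compress, hSV, hSV]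
  have hfA := cfc_comp_of_intertwine hfc hA hA' hAS
  have hfB := cfc_comp_of_intertwine hfc hB (hB.compress hRiso) hBR'
  have key := h V' hV'iso
  have hfL : ∀ x ∈ L, cfc f A (V x) = V (cfc f B x) := by
    intro x hx
    have hBL := hB.compress (adjoint_subtypeL_comp_subtypeL L)
    have h1 : B ∘L L.subtypeL = L.subtypeL ∘L compress L.subtypeL B :=
      comp_subtypeL_eq_of_invariant L fun x hx => (hLB x hx).1
    have h2 : A ∘L (V ∘L L.subtypeL) = (V ∘L L.subtypeL) ∘L compress L.subtypeL B := by
      rw [comp_assoc V, ← h1]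
      ext z
      exact (hLB z z.2).2
    have h3 := DFunLike.congr_fun (cfc_comp_of_intertwine hfc hB hBL h1) ⟨x, hx⟩
    have h4 := DFunLike.congr_fun (cfc_comp_of_intertwine hfc hA hBL h2) ⟨x, hx⟩
    simp only [comp_apply, Submodule.subtypeL_apply] at h3 h4
    rw [h3, h4]
  have hfAsa := isSelfAdjoint_cfc_real f A
  have hfBsa := isSelfAdjoint_cfc_real f B
  rw [opLE_iff hfBsa (isSelfAdjoint_compress V hfAsa)]
  intro q
  obtain ⟨l, hl, r, hr, rfl⟩ := L.exists_add_mem_mem_orthogonal q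
  have e1 : ⟪cfc f A (V l), V (l + r)⟫_ℂ = ⟪cfc f B l, l + r⟫_ℂ := by rw [hfL l hl, hVi]
  have e2 : ⟪cfc f A (V r), V l⟫_ℂ = ⟪cfc f B r, l⟫_ℂ := by
    rw [hfAsa.inner_apply_left, hfL l hl, hVi, hfBsa.inner_apply_left]
  have e3 : RCLike.re ⟪cfc f B r, r⟫_ℂ ≤ RCLike.re ⟪cfc f A (V r), V r⟫_ℂ := by
    have h5 := (opLE_iff (isSelfAdjoint_cfc_real f _) (isSelfAdjoint_compress V'
      (isSelfAdjoint_cfc_real f _))).1 key ⟨r, hr⟩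
    rw [← hcomp, inner_compress] at h5
    have h6 : cfc f B r = R (cfc f (compress R B) ⟨r, hr⟩) := DFunLike.congr_fun hfB ⟨r, hr⟩
    have h7 : cfc f A (S (V' ⟨r, hr⟩)) = S (cfc f A' (V' ⟨r, hr⟩)) := DFunLike.congr_fun hfA _
    have h8 : V r = S (V' ⟨r, hr⟩) := (hSV ⟨r, hr⟩).symm
    rw [h6, h8, h7, inner_map_map_of_isometry hSiso]
    rw [← inner_map_map_of_isometry hRiso] at h5
    exact h5
  rw [inner_compress, map_add (cfc f B), map_add V l r, map_add (cfc f A), inner_add_left,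
    inner_add_left, ← map_add V l r, e1, map_add V l r, inner_add_right (cfc f A (V r)), e2,
    inner_add_right (cfc f B r)]
  simp only [map_add] at e3 ⊢
  linarith

end Glue

section FiniteDimensionalJensen

open ContinuousLinearMap Module

section General

variable {K : Type*} [NormedAddCommGroup K] [InnerProductSpace ℂ K] [CompleteSpace K]

lemma inner_eq_zero_of_eigen {A : K →L[ℂ] K} (hA : IsSelfAdjoint A) {a ν : ℝ} (h : ν ≠ a)
    {w x v : K} (hx : A x = (a : ℂ) • x) (hv : A v = w + (ν : ℂ) • v) (hw : ⟪w, x⟫_ℂ = 0) :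
    ⟪v, x⟫_ℂ = 0 := by
  have h1 := hA.inner_apply_left v x
  rw [hv, hx, inner_add_left, hw, inner_smul_left, inner_smul_right, zero_add,
    Complex.conj_ofReal] at h1
  have h2 : ((ν : ℂ) - a) * ⟪v, x⟫_ℂ = 0 := by rw [sub_mul, h1, sub_self]
  exact (mul_eq_zero.1 h2).resolve_left (sub_ne_zero.2 (by exact_mod_cast h))

lemma apply_eq_of_inner_eq_zero {P : K →L[ℂ] K} (hP : 0 ≤ P) {v : K} (h : ⟪P v, v⟫_ℂ = 0) :
    P v = 0 := by
  have h1 : CFC.sqrt P * CFC.sqrt P = P := CFC.sqrt_mul_sqrt_self P hP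
  have hs : IsSelfAdjoint (CFC.sqrt P) := .of_nonneg (CFC.sqrt_nonneg P)
  have h2 : P v = CFC.sqrt P (CFC.sqrt P v) := by
    conv_lhs => rw [← h1]
    rfl
  rw [h2, hs.inner_apply_left, inner_self_eq_zero] at h
  rw [h2, h, map_zero]

/-- If `ν = ⟪A v, v⟫ / ⟪v, v⟫` is an endpoint of an interval containing the spectrum of `A`, then
`v` is an eigenvector. -/
lemma OpBetween.sub_eq_zero_of_endpoint {a b ν : ℝ} {A : K →L[ℂ] K} (hA : OpBetween a b A)
    {v w : K} (hv : A v = w + (ν : ℂ) • v) (hw : ⟪w, v⟫_ℂ = 0) (h : ν = a ∨ ν = b) : w = 0 := by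
  rcases h with rfl | rfl
  · have h1 := apply_eq_of_inner_eq_zero (sub_nonneg.2 hA.1) (v := v) (by
      simp [hv, hw])
    simpa [algebraMap_real_apply, hv] using h1
  · have h1 := apply_eq_of_inner_eq_zero (sub_nonneg.2 hA.2) (v := v) (by
      simp [hv, hw])
    simpa [algebraMap_real_apply, hv] using h1

end General

lemma finrank_comap_of_le {K : Type*} [AddCommGroup K] [Module ℂ K] {L M : Submodule ℂ K}
    (h : L ≤ M) :
    finrank ℂ (L.comap M.subtype) = finrank ℂ L :=
  (Submodule.comapSubtypeEquivOfLe h).finrank_eq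

lemma injective_of_isometry {E F : Type*} [NormedAddCommGroup E] [InnerProductSpace ℂ E]
    [CompleteSpace E] [NormedAddCommGroup F] [InnerProductSpace ℂ F] [CompleteSpace F]
    {V : E →L[ℂ] F} (hV : adjoint V ∘L V = .id ℂ E) : Function.Injective V :=
  Function.LeftInverse.injective (adjoint_apply_apply_of_isometry hV)

lemma finrank_le_finrank_comap_orthogonal {K : Type*} [NormedAddCommGroup K]
    [InnerProductSpace ℂ K] [FiniteDimensional ℂ K] (L N : Submodule ℂ K) :
    finrank ℂ L ≤ finrank ℂ (L.comap Nᗮ.subtype) + finrank ℂ N := by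
  have h1 := Submodule.finrank_sup_add_finrank_inf_eq Nᗮ L
  have h2 := N.finrank_add_finrank_orthogonal
  have h3 : finrank ℂ (L.comap Nᗮ.subtype) = finrank ℂ (Nᗮ ⊓ L : Submodule ℂ K) := by
    rw [← Submodule.map_comap_subtype, Submodule.finrank_map_subtype_eq]
  have h4 := Submodule.finrank_le (Nᗮ ⊔ L)
  omega

/-- Jensen's inequality `f(V* A V) ≤ V* f(A) V` on all `n`-dimensional spaces for operators
`a ≤ A ≤ b` such that the eigenspaces of `a` and `b` have total dimension at least `n - m`. -/
def CompressionJensen (f : ℝ → ℝ) (a b : ℝ) (m n : ℕ) : Prop :=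
  ∀ (K : Type u) [NormedAddCommGroup K] [InnerProductSpace ℂ K] [CompleteSpace K]
    [FiniteDimensional ℂ K] (Q : Type u) [NormedAddCommGroup Q] [InnerProductSpace ℂ Q]
    [CompleteSpace Q] (A : K →L[ℂ] K) (La Lb : Submodule ℂ K) (V : Q →L[ℂ] K),
    OpBetween a b A → (∀ x ∈ La, A x = (a : ℂ) • x) → (∀ x ∈ Lb, A x = (b : ℂ) • x) →
    finrank ℂ K = n → n ≤ m + finrank ℂ La + finrank ℂ Lb → adjoint V ∘L V = .id ℂ Q →
    cfc f (compress V A) ≤ compress V (cfc f A)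

variable {K Q : Type u} [NormedAddCommGroup K] [InnerProductSpace ℂ K] [CompleteSpace K]
  [FiniteDimensional ℂ K] [NormedAddCommGroup Q] [InnerProductSpace ℂ Q] [CompleteSpace Q]

lemma compress_subtypeL_apply_of_eigen {A : K →L[ℂ] K} {La : Submodule ℂ K} {a : ℝ}
    (h : ∀ x ∈ La, A x = (a : ℂ) • x) (M : Submodule ℂ K) :
    ∀ x ∈ La.comap M.subtype, compress M.subtypeL A x = (a : ℂ) • x := by
  have : CompleteSpace M := FiniteDimensional.complete ℂ M
  intro x hx
  have hx' : A (M.subtypeL x) = (a : ℂ) • M.subtypeL x := h _ hx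
  change adjoint M.subtypeL (A (M.subtypeL x)) = _
  rw [hx', map_smul,
    adjoint_apply_apply_of_isometry (adjoint_subtypeL_comp_subtypeL M)]

/-- The inductive step when the compressed operator has an eigenvector which is mapped to an
eigenvector. -/
lemma CompressionJensen.cfc_compress_le_of_eigenvector {f : ℝ → ℝ} {a b : ℝ} {m n : ℕ}
    (hJ : CompressionJensen.{u} f a b m n) (hfc : ContinuousOn f (Set.Icc a b))
    {A : K →L[ℂ] K} (hA : OpBetween a b A) {La Lb : Submodule ℂ K}
    (hLa : ∀ x ∈ La, A x = (a : ℂ) • x) (hLb : ∀ x ∈ Lb, A x = (b : ℂ) • x)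
    (hK : finrank ℂ K = n + 1) {V : Q →L[ℂ] K} (hV : adjoint V ∘L V = .id ℂ Q)
    {y : Q} (hy : y ≠ 0) {ν : ℝ} (hν : A (V y) = (ν : ℂ) • V y)
    (hn : n ≤ m + finrank ℂ (La.comap (ℂ ∙ V y)ᗮ.subtype) +
      finrank ℂ (Lb.comap (ℂ ∙ V y)ᗮ.subtype)) :
    cfc f (compress V A) ≤ compress V (cfc f A) := by
  have hmap : (ℂ ∙ y).map (V : Q →ₗ[ℂ] K) = ℂ ∙ V y := by
    rw [Submodule.map_span, Set.image_singleton]; rfl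
  have hVy : V y ≠ 0 := fun h0 => hy (injective_of_isometry hV (by simpa using h0))
  refine cfc_compress_le_of_orthogonal hfc hA hV (ℂ ∙ y) ?_ ?_
  · intro x hx
    obtain ⟨c, rfl⟩ := Submodule.mem_span_singleton.1 hx
    refine ⟨(ν : ℂ) • c • y, Submodule.smul_mem _ _ hx, ?_⟩
    change V ((ν : ℂ) • c • y) = A (V (c • y))
    rw [map_smul, map_smul, map_smul, hν, smul_comm]
  · rw [hmap]
    intro V' hV'
    refine hJ _ _ _ (La.comap _) (Lb.comap _) V' (hA.compress (adjoint_subtypeL_comp_subtypeL _))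
      (compress_subtypeL_apply_of_eigen hLa _) (compress_subtypeL_apply_of_eigen hLb _) ?_ hn hV'
    have h1 := (ℂ ∙ V y).finrank_add_finrank_orthogonal
    rw [finrank_span_singleton hVy] at h1
    omega

lemma exists_eigenvector [Nontrivial K] {B : K →L[ℂ] K} (hB : IsSelfAdjoint B) :
    ∃ (ν : ℝ) (y : K), y ≠ 0 ∧ B y = (ν : ℂ) • y := by
  obtain ⟨c, hc⟩ := Module.End.exists_eigenvalue (B : K →ₗ[ℂ] K)
  obtain ⟨y, hy⟩ := hc.exists_hasEigenvector
  have h1 := (isSelfAdjoint_iff_isSymmetric.1 hB).conj_eigenvalue_eq_self hc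
  obtain ⟨ν, rfl⟩ := Complex.conj_eq_iff_real.1 h1
  exact ⟨ν, y, hy.2, hy.apply_eq_smul⟩

/-- Jensen's inequality for compressions of operators with few eigenvalues in the interior of the
interval `[a, b]`. -/
theorem compressionJensen {f : ℝ → ℝ} {a b : ℝ} (ha : 0 < a) (hab : a < b)
    (hfc : ContinuousOn f (Set.Icc a b)) (m : ℕ)
    (hconv : ∀ (E : Type u) [NormedAddCommGroup E] [InnerProductSpace ℂ E] [CompleteSpace E]
      [FiniteDimensional ℂ E], finrank ℂ E ≤ m + 2 → IsOperatorConvexOn E f) (n : ℕ) :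
    CompressionJensen.{u} f a b m n := by
  induction n using Nat.strong_induction_on with
  | _ n ih =>
  intro K _ _ _ _ Q _ _ _ A La Lb V hA hLa hLb hK hn hV
  have : FiniteDimensional ℂ Q :=
    FiniteDimensional.of_injective (V : Q →ₗ[ℂ] K) (injective_of_isometry hV)
  rcases subsingleton_or_nontrivial Q with hQ | hQ
  · exact le_of_eq (ContinuousLinearMap.ext fun x => Subsingleton.elim _ _)
  obtain ⟨ν, y, hy, hBy⟩ := exists_eigenvector (hA.compress hV).isSelfAdjoint
  have hVx := adjoint_apply_apply_of_isometry hV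
  have hVy : V y ≠ 0 := fun h0 => hy (injective_of_isometry hV (by simpa using h0))
  obtain ⟨w, hw⟩ : ∃ w, w = A (V y) - (ν : ℂ) • V y := ⟨_, rfl⟩
  have hAVy : A (V y) = w + (ν : ℂ) • V y := by rw [hw, sub_add_cancel]
  have hVw : ∀ q, ⟪w, V q⟫_ℂ = 0 := by
    intro q
    have : adjoint V w = 0 := by
      rw [hw, map_sub, map_smul, hVx, sub_eq_zero]
      exact hBy
    rw [← adjoint_inner_left, this, inner_zero_left]
  have hKpos : 0 < finrank ℂ K := finrank_pos_iff_exists_ne_zero.2 ⟨_, hVy⟩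
  obtain ⟨n, rfl⟩ : ∃ k, n = k + 1 := ⟨n - 1, by omega⟩
  by_cases hw0 : w = 0
  · refine (ih n (by omega)).cfc_compress_le_of_eigenvector hfc hA hLa hLb hK hV hy
      (by rw [hAVy, hw0, zero_add]) ?_
    have h1 := finrank_le_finrank_comap_orthogonal La (ℂ ∙ V y)
    have h2 := finrank_le_finrank_comap_orthogonal Lb (ℂ ∙ V y)
    rw [finrank_span_singleton hVy] at h1 h2
    have h3 : ∀ {L : Submodule ℂ K} {c : ℝ}, (∀ x ∈ L, A x = (c : ℂ) • x) → ν ≠ c →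
        finrank ℂ (L.comap (ℂ ∙ V y)ᗮ.subtype) = finrank ℂ L := fun hL hc =>
      finrank_comap_of_le fun x hx => Submodule.mem_orthogonal_singleton_iff_inner_right.2
        (inner_eq_zero_of_eigen hA.isSelfAdjoint hc (hL x hx) hAVy (by simp [hw0]))
    by_cases hνa : ν = a
    · have h4 := h3 hLb (by rw [hνa]; exact hab.ne)
      omega
    · have h4 := h3 hLa hνa
      omega
  have hνab : ¬ (ν = a ∨ ν = b) := fun h =>
    hw0 (hA.sub_eq_zero_of_endpoint hAVy (hVw y) h)
  push Not at hνab
  obtain ⟨hνa, hνb⟩ := hνab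
  set K₁ := (ℂ ∙ w)ᗮ with hK₁
  have hmemK₁ : ∀ {x}, x ∈ K₁ ↔ ⟪w, x⟫_ℂ = 0 := Submodule.mem_orthogonal_singleton_iff_inner_right
  have hdimK₁ := (ℂ ∙ w).finrank_add_finrank_orthogonal
  rw [finrank_span_singleton hw0, ← hK₁] at hdimK₁
  set J := K₁.subtypeL with hJ
  have hJiso : adjoint J ∘L J = .id ℂ K₁ := adjoint_subtypeL_comp_subtypeL _
  set V₁ : Q →L[ℂ] K₁ := adjoint J ∘L V with hV₁
  have hJV₁ : ∀ q, J (V₁ q) = V q := fun q =>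
    subtypeL_adjoint_apply_of_mem K₁ (hmemK₁.2 (hVw q))
  have hV₁iso : adjoint V₁ ∘L V₁ = .id ℂ Q := by
    refine ContinuousLinearMap.ext fun x => ext_inner_right ℂ fun z => ?_
    rw [comp_apply, adjoint_inner_left, id_apply, ← inner_map_map_of_isometry hJiso, hJV₁, hJV₁,
      inner_map_map_of_isometry hV]
  set A₁ := compress J A with hA₁
  have hA₁b : OpBetween a b A₁ := hA.compress hJiso
  set La₁ := La.comap K₁.subtype with hLa₁
  set Lb₁ := Lb.comap K₁.subtype with hLb₁
  have hLa₁' : ∀ x ∈ La₁, A₁ x = (a : ℂ) • x := compress_subtypeL_apply_of_eigen hLa _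
  have hLb₁' : ∀ x ∈ Lb₁, A₁ x = (b : ℂ) • x := compress_subtypeL_apply_of_eigen hLb _
  have hdLa : finrank ℂ La ≤ finrank ℂ La₁ + 1 :=
    finrank_span_singleton (K := ℂ) hw0 ▸ finrank_le_finrank_comap_orthogonal La (ℂ ∙ w)
  have hdLb : finrank ℂ Lb ≤ finrank ℂ Lb₁ + 1 :=
    finrank_span_singleton (K := ℂ) hw0 ▸ finrank_le_finrank_comap_orthogonal Lb (ℂ ∙ w)
  -- compression of `A` to `wᗮ`
  have hfirst : cfc f A₁ ≤ compress J (cfc f A) := by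
    refine cfc_compress_le_of_orthogonal hfc hA hJiso (La₁ ⊔ Lb₁) ?_ fun V' hV' =>
      (hconv _ ?_).cfc_compress_le hfc ha (hA.compress (adjoint_subtypeL_comp_subtypeL _)) hV'
    · intro x hx
      obtain ⟨p, hp, q, hq, rfl⟩ := Submodule.mem_sup.1 hx
      refine ⟨(a : ℂ) • p + (b : ℂ) • q, Submodule.add_mem_sup (Submodule.smul_mem _ _ hp)
        (Submodule.smul_mem _ _ hq), ?_⟩
      have h1 : A (J p) = (a : ℂ) • J p := hLa _ hp
      have h2 : A (J q) = (b : ℂ) • J q := hLb _ hq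
      rw [map_add J p q, map_add A, h1, h2]
      exact (map_add J _ _).trans (by rw [map_smul, map_smul])
    · have h1 := ((La₁ ⊔ Lb₁).map (J : K₁ →ₗ[ℂ] K)).finrank_add_finrank_orthogonal
      have h2 : finrank ℂ ((La₁ ⊔ Lb₁).map (J : K₁ →ₗ[ℂ] K)) = finrank ℂ ↥(La₁ ⊔ Lb₁) :=
        Submodule.finrank_map_subtype_eq K₁ _
      have h3 := Submodule.finrank_sup_add_finrank_inf_eq La₁ Lb₁
      have h4 : La₁ ⊓ Lb₁ = ⊥ := by
        refine (Submodule.eq_bot_iff _).2 fun x hx => ?_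
        have h5 := (hLa₁' x hx.1).symm.trans (hLb₁' x hx.2)
        rw [← sub_eq_zero, ← sub_smul, smul_eq_zero, sub_eq_zero] at h5
        exact h5.resolve_left (by exact_mod_cast hab.ne)
      rw [h4, finrank_bot] at h3
      omega
  have hAV₁y : A₁ (V₁ y) = (ν : ℂ) • V₁ y := by
    refine ext_inner_right ℂ fun z => ?_
    have hz : ⟪w, J z⟫_ℂ = 0 := hmemK₁.1 z.2
    rw [inner_compress, hJV₁, hAVy, inner_add_left, hz, zero_add, inner_smul_left,
      inner_smul_left, ← inner_map_map_of_isometry hJiso, hJV₁]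
  -- compression of `A₁` to the range of `V₁`
  have hsecond : cfc f (compress V₁ A₁) ≤ compress V₁ (cfc f A₁) := by
    have hpos : 0 < finrank ℂ K₁ := finrank_pos_iff_exists_ne_zero.2 ⟨V₁ y, fun h0 => hVy (by
      rw [← hJV₁, h0, map_zero])⟩
    obtain ⟨k, rfl⟩ : ∃ k, n = k + 1 := ⟨n - 1, by omega⟩
    refine (ih k (by omega)).cfc_compress_le_of_eigenvector hfc hA₁b hLa₁' hLb₁' (by omega)
      hV₁iso hy hAV₁y ?_
    have h3 : ∀ {L : Submodule ℂ K₁} {c : ℝ}, (∀ x ∈ L, A₁ x = (c : ℂ) • x) → ν ≠ c →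
        finrank ℂ (L.comap (ℂ ∙ V₁ y)ᗮ.subtype) = finrank ℂ L := fun hL hc =>
      finrank_comap_of_le fun x hx => Submodule.mem_orthogonal_singleton_iff_inner_right.2
        (inner_eq_zero_of_eigen (w := 0) hA₁b.isSelfAdjoint hc (hL x hx)
          (by rw [hAV₁y, zero_add]) (by simp))
    rw [h3 hLa₁' hνa, h3 hLb₁' hνb]
    omega
  have hc : ∀ D : K →L[ℂ] K, compress V₁ (compress J D) = compress V D := by
    intro D
    refine ContinuousLinearMap.ext fun x => ext_inner_right ℂ fun z => ?_
    rw [inner_compress, inner_compress, inner_compress, hJV₁, hJV₁]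
  rw [← hc, ← hc]
  exact hsecond.trans (compress_mono V₁ hfirst)

end FiniteDimensionalJensen

section WeightedJensen

open ContinuousLinearMap Module

variable {ι : Type} [Fintype ι]

lemma opBetween_algebraMap {E : Type*} [NormedAddCommGroup E] [InnerProductSpace ℂ E]
    [CompleteSpace E] {a b c : ℝ} (hc : c ∈ Set.Icc a b) :
    OpBetween a b (algebraMap ℝ (E →L[ℂ] E) c) :=
  ⟨algebraMap_mono _ hc.1, algebraMap_mono _ hc.2⟩

section Diagonal

variable {W : ι → Type u} [∀ i, NormedAddCommGroup (W i)] [∀ i, InnerProductSpace ℂ (W i)]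
  [∀ i, FiniteDimensional ℂ (W i)]

/-- The diagonal operator with entries `μ i` on a finite Hilbert sum. -/
noncomputable def diagonalOperator (W : ι → Type u) [∀ i, NormedAddCommGroup (W i)]
    [∀ i, InnerProductSpace ℂ (W i)] [∀ i, FiniteDimensional ℂ (W i)] (μ : ι → ℝ) :
    PiLp 2 W →L[ℂ] PiLp 2 W :=
  LinearMap.toContinuousLinearMap
    { toFun := fun k => WithLp.toLp 2 fun i => (μ i : ℂ) • k i
      map_add' := fun x y => by ext i; simp
      map_smul' := fun c x => by ext i; simp [smul_comm (μ i : ℂ) c] }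

lemma diagonalOperator_apply (μ : ι → ℝ) (k : PiLp 2 W) (i : ι) :
    diagonalOperator W μ k i = (μ i : ℂ) • k i := rfl

lemma opBetween_diagonalOperator [∀ i, CompleteSpace (W i)] {a b : ℝ} {μ : ι → ℝ}
    (hμ : ∀ i, μ i ∈ Set.Icc a b) : OpBetween a b (diagonalOperator W μ) := by
  have hsa : IsSelfAdjoint (diagonalOperator W μ) := by
    rw [isSelfAdjoint_iff_isSymmetric]
    intro x y
    change ⟪diagonalOperator W μ x, y⟫_ℂ = ⟪x, diagonalOperator W μ y⟫_ℂ
    rw [PiLp.inner_apply, PiLp.inner_apply]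
    refine Finset.sum_congr rfl fun i _ => ?_
    rw [diagonalOperator_apply, diagonalOperator_apply, inner_smul_left, inner_smul_right,
      Complex.conj_ofReal]
  rw [opBetween_iff hsa]
  intro x
  have h1 : RCLike.re ⟪diagonalOperator W μ x, x⟫_ℂ = ∑ i, μ i * ‖x i‖ ^ 2 := by
    rw [PiLp.inner_apply, map_sum]
    refine Finset.sum_congr rfl fun i _ => ?_
    rw [diagonalOperator_apply, inner_smul_left, Complex.conj_ofReal,
      ← inner_self_eq_norm_sq (𝕜 := ℂ)]
    exact Complex.re_ofReal_mul _ _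
  rw [h1, PiLp.norm_sq_eq_of_L2, Finset.mul_sum, Finset.mul_sum]
  exact ⟨Finset.sum_le_sum fun i _ => by gcongr; exact (hμ i).1,
    Finset.sum_le_sum fun i _ => by gcongr; exact (hμ i).2⟩

lemma cfc_diagonalOperator [∀ i, CompleteSpace (W i)] {a b : ℝ} {μ : ι → ℝ}
    (hμ : ∀ i, μ i ∈ Set.Icc a b) {f : ℝ → ℝ} (hfc : ContinuousOn f (Set.Icc a b)) :
    cfc f (diagonalOperator W μ) = diagonalOperator W (fun i => f (μ i)) := by
  ext k i
  have h := cfc_comp_of_intertwine hfc (A := algebraMap ℝ (W i →L[ℂ] W i) (μ i))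
    (V := PiLp.proj 2 W i) (opBetween_algebraMap (hμ i)) (opBetween_diagonalOperator hμ) (by
      ext k
      simp [diagonalOperator_apply])
  rw [cfc_algebraMap] at h
  have h' := DFunLike.congr_fun h k
  simp only [comp_apply, PiLp.proj_apply, algebraMap_real_apply] at h'
  rw [← h', diagonalOperator_apply]

end Diagonal

variable {f : ℝ → ℝ} {a b : ℝ} {μ : ι → ℝ} {i₀ i₁ : ι}

/-- Jensen's inequality for weights `T* T`, where the weights belonging to interior points have
rank at most one. -/
lemma cfc_sum_le_of_finrank_le_one {Q : Type u} [NormedAddCommGroup Q]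
    [InnerProductSpace ℂ Q] [CompleteSpace Q] [FiniteDimensional ℂ Q]
    {W : ι → Type u} [∀ i, NormedAddCommGroup (W i)] [∀ i, InnerProductSpace ℂ (W i)]
    [∀ i, FiniteDimensional ℂ (W i)] [∀ i, CompleteSpace (W i)]
    (ha : 0 < a) (hab : a < b) (hfc : ContinuousOn f (Set.Icc a b))
    (hconv : ∀ (E : Type u) [NormedAddCommGroup E] [InnerProductSpace ℂ E] [CompleteSpace E]
      [FiniteDimensional ℂ E], finrank ℂ E ≤ Fintype.card ι → IsOperatorConvexOn E f)
    (hμ : ∀ i, μ i ∈ Set.Icc a b) (h₀ : μ i₀ = a) (h₁ : μ i₁ = b)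
    (T : ∀ i, Q →L[ℂ] W i) (hT : ∑ i, adjoint (T i) ∘L T i = 1)
    (hrank : ∀ i, i ≠ i₀ → i ≠ i₁ → finrank ℂ (W i) ≤ 1) :
    cfc f (∑ i, (μ i : ℂ) • (adjoint (T i) ∘L T i)) ≤
      ∑ i, (f (μ i) : ℂ) • (adjoint (T i) ∘L T i) := by
  classical
  have hne : i₀ ≠ i₁ := fun h => by rw [h, h₁] at h₀; exact hab.ne' h₀
  let V : Q →L[ℂ] PiLp 2 W := LinearMap.toContinuousLinearMap
    { toFun := fun q => WithLp.toLp 2 fun i => T i q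
      map_add' := fun x y => by ext i; simp
      map_smul' := fun c x => by ext i; simp }
  have hVi : ∀ (x : Q) (i : ι), V x i = T i x := fun x i => rfl
  have hinner : ∀ (c : ι → ℝ) (x y : Q), ⟪diagonalOperator W c (V x), V y⟫_ℂ =
      ⟪(∑ i, (c i : ℂ) • (adjoint (T i) ∘L T i)) x, y⟫_ℂ := by
    intro c x y
    rw [PiLp.inner_apply, sum_apply, sum_inner]
    refine Finset.sum_congr rfl fun i _ => ?_
    rw [diagonalOperator_apply, inner_smul_left, smul_apply, inner_smul_left, comp_apply,
      adjoint_inner_left, hVi, hVi]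
  have hcomp : ∀ c : ι → ℝ, compress V (diagonalOperator W c) =
      ∑ i, (c i : ℂ) • (adjoint (T i) ∘L T i) := fun c =>
    ContinuousLinearMap.ext fun x => ext_inner_right ℂ fun y => by rw [inner_compress, hinner]
  have hV : adjoint V ∘L V = .id ℂ Q := by
    have h1 : diagonalOperator W (fun _ => 1) = 1 := by
      ext k i
      rw [diagonalOperator_apply, Complex.ofReal_one, one_smul, one_apply_eq_self]
    have h2 := hcomp fun _ => 1
    simp only [Complex.ofReal_one, one_smul, hT, h1] at h2
    exact h2
  let incl : ∀ i, W i →ₗ[ℂ] PiLp 2 W := fun i =>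
    (WithLp.linearEquiv 2 ℂ (∀ i, W i)).symm.toLinearMap ∘ₗ LinearMap.single ℂ W i
  have hincl : ∀ i, Function.Injective (incl i) := fun i =>
    (WithLp.linearEquiv 2 ℂ (∀ i, W i)).symm.injective.comp
      (LinearMap.ker_eq_bot.1 (LinearMap.ker_single ℂ W i))
  have heig : ∀ i, ∀ x ∈ (incl i).range, diagonalOperator W μ x = (μ i : ℂ) • x := by
    rintro i _ ⟨w, rfl⟩
    ext j
    change (μ j : ℂ) • (Pi.single i w : ∀ i, W i) j = (μ i : ℂ) • (Pi.single i w : ∀ i, W i) j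
    by_cases hij : j = i
    · subst hij; rfl
    · rw [Pi.single_eq_of_ne hij, smul_zero, smul_zero]
  have hdim : finrank ℂ (PiLp 2 W) = ∑ i, finrank ℂ (W i) := by
    rw [← finrank_pi_fintype ℂ]
    exact (WithLp.linearEquiv 2 ℂ (∀ i, W i)).finrank_eq
  have hsum : finrank ℂ (W i₀) + (finrank ℂ (W i₁) +
      ∑ i ∈ (Finset.univ.erase i₀).erase i₁, finrank ℂ (W i)) = ∑ i, finrank ℂ (W i) := by
    rw [Finset.add_sum_erase _ (fun i => finrank ℂ (W i))
      (Finset.mem_erase.2 ⟨hne.symm, Finset.mem_univ _⟩),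
      Finset.add_sum_erase _ (fun i => finrank ℂ (W i)) (Finset.mem_univ _)]
  have hcard : ((Finset.univ.erase i₀).erase i₁).card + 2 = Fintype.card ι := by
    have h2 := Finset.card_erase_add_one (Finset.mem_erase.2 ⟨hne.symm, Finset.mem_univ i₁⟩)
    have h3 := Finset.card_erase_add_one (Finset.mem_univ i₀)
    rw [Finset.card_univ] at h3
    omega
  have hsum_le : ∑ i ∈ (Finset.univ.erase i₀).erase i₁, finrank ℂ (W i) ≤
      ((Finset.univ.erase i₀).erase i₁).card := by
    have h4 := Finset.sum_le_card_nsmul ((Finset.univ.erase i₀).erase i₁)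
      (fun i => finrank ℂ (W i)) 1 fun i hi => hrank i
        (Finset.ne_of_mem_erase (Finset.mem_of_mem_erase hi)) (Finset.ne_of_mem_erase hi)
    simpa using h4
  have key := compressionJensen ha hab hfc ((Finset.univ.erase i₀).erase i₁).card
    (fun E _ _ _ _ hE => hconv E (hE.trans hcard.le)) (finrank ℂ (PiLp 2 W)) (PiLp 2 W) Q
    (diagonalOperator W μ) (incl i₀).range (incl i₁).range V
    (opBetween_diagonalOperator hμ) (h₀ ▸ heig i₀) (h₁ ▸ heig i₁) rfl (by
      rw [LinearMap.finrank_range_of_inj (hincl i₀), LinearMap.finrank_range_of_inj (hincl i₁)]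
      omega) hV
  rwa [cfc_diagonalOperator hμ hfc, hcomp, hcomp] at key

end WeightedJensen

section WeightedJensen

open ContinuousLinearMap Module

lemma re_inner_le_of_le {E : Type*} [NormedAddCommGroup E] [InnerProductSpace ℂ E]
    [CompleteSpace E] {A B : E →L[ℂ] E} (h : A ≤ B) (x : E) :
    RCLike.re ⟪A x, x⟫_ℂ ≤ RCLike.re ⟪B x, x⟫_ℂ := by
  rw [le_def] at h
  have := h.re_inner_nonneg_left x
  rwa [sub_apply, inner_sub_left, map_sub, sub_nonneg] at this

variable {ι : Type} [Fintype ι] {f : ℝ → ℝ} {a b : ℝ} {μ : ι → ℝ} {i₀ i₁ : ι}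

/-- Moving the mass `R j` from interior points of `[a, b]` to the endpoints, keeping total mass
and barycenter. -/
lemma exists_weights_of_le {E : Type*} [NormedAddCommGroup E] [InnerProductSpace ℂ E]
    [CompleteSpace E] (hab : a < b) (hμ : ∀ i, μ i ∈ Set.Icc a b) (h₀ : μ i₀ = a) (h₁ : μ i₁ = b)
    (F R : ι → E →L[ℂ] E) (hR : ∀ i, 0 ≤ R i) (hRF : ∀ i, R i ≤ F i) :
    ∃ G : ι → E →L[ℂ] E, (∀ i, 0 ≤ G i) ∧ (∀ i, i ≠ i₀ → i ≠ i₁ → G i = F i - R i) ∧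
      ∑ i, G i = ∑ i, F i ∧ ∑ i, μ i • G i = ∑ i, μ i • F i ∧
      ∀ x, (∀ i, R i x = 0) → ∀ i, G i x = F i x := by
  classical
  let θ : ι → ℝ := fun i => (b - μ i) / (b - a)
  have hba : 0 < b - a := sub_pos.2 hab
  have hθ0 : ∀ i, 0 ≤ θ i := fun i => div_nonneg (sub_nonneg.2 (hμ i).2) hba.le
  have hθ1 : ∀ i, 0 ≤ 1 - θ i := fun i => by
    rw [sub_nonneg, div_le_one hba]
    linarith [(hμ i).1]
  refine ⟨fun i => (F i - R i) + ((if i = i₀ then ∑ j, θ j • R j else 0) +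
    (if i = i₁ then ∑ j, (1 - θ j) • R j else 0)), ?_, ?_, ?_, ?_, ?_⟩
  · intro i
    refine add_nonneg (sub_nonneg.2 (hRF i)) (add_nonneg ?_ ?_)
    · split_ifs
      · exact Finset.sum_nonneg fun j _ => smul_nonneg (hθ0 j) (hR j)
      · exact le_rfl
    · split_ifs
      · exact Finset.sum_nonneg fun j _ => smul_nonneg (hθ1 j) (hR j)
      · exact le_rfl
  · intro i h h'
    simp [h, h']
  · rw [Finset.sum_add_distrib, Finset.sum_add_distrib, Finset.sum_sub_distrib, Finset.sum_ite_eq',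
      Finset.sum_ite_eq', if_pos (Finset.mem_univ _), if_pos (Finset.mem_univ _),
      ← Finset.sum_add_distrib]
    have : ∀ j, θ j • R j + (1 - θ j) • R j = R j := fun j => by module
    simp only [this, sub_add_cancel]
  · simp only [smul_add, smul_sub, smul_ite, smul_zero]
    rw [Finset.sum_add_distrib, Finset.sum_add_distrib, Finset.sum_sub_distrib, Finset.sum_ite_eq',
      Finset.sum_ite_eq', if_pos (Finset.mem_univ _), if_pos (Finset.mem_univ _), h₀, h₁,
      Finset.smul_sum, Finset.smul_sum, ← Finset.sum_add_distrib]
    have : ∀ j, a • θ j • R j + b • (1 - θ j) • R j = μ j • R j := fun j => by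
      rw [smul_smul, smul_smul, ← add_smul]
      congr 1
      have : θ j * (b - a) = b - μ j := div_mul_cancel₀ _ hba.ne'
      linarith
    simp only [this, sub_add_cancel]
  · intro x hx i
    have h2 : ∀ c : ι → ℝ, (∑ j, c j • R j) x = 0 := fun c => by
      simp [sum_apply, hx]
    simp only [add_apply, sub_apply, hx]
    split_ifs <;> simp [h2]

/-- The part of a positive operator which is seen by the vector `x` has rank at most one. -/
lemma exists_finrank_le_one_le {E : Type*} [NormedAddCommGroup E] [InnerProductSpace ℂ E]
    [CompleteSpace E] {P : E →L[ℂ] E} (hP : 0 ≤ P) (x : E) :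
    ∃ (N : Submodule ℂ E) (_ : CompleteSpace N) (T : E →L[ℂ] N), finrank ℂ N ≤ 1 ∧
      adjoint T ∘L T ≤ P ∧ adjoint T (T x) = P x := by
  have hsqrt : ∀ y, CFC.sqrt P (CFC.sqrt P y) = P y := fun y => by
    conv_rhs => rw [← CFC.sqrt_mul_sqrt_self P hP]
    rfl
  have hsa : IsSelfAdjoint (CFC.sqrt P) := .of_nonneg (CFC.sqrt_nonneg P)
  obtain ⟨N, hN, hNx, hN1⟩ : ∃ (N : Submodule ℂ E) (_ : CompleteSpace N),
      CFC.sqrt P x ∈ N ∧ finrank ℂ N ≤ 1 :=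
    ⟨ℂ ∙ CFC.sqrt P x, FiniteDimensional.complete ℂ _, Submodule.mem_span_singleton_self _,
      (finrank_span_le_card {CFC.sqrt P x}).trans (by simp)⟩
  refine ⟨N, hN, adjoint N.subtypeL ∘L CFC.sqrt P, hN1, ?_, ?_⟩
  · rw [opLE_iff (isPositive_adjoint_comp_self _).isSelfAdjoint (.of_nonneg hP)]
    intro y
    have h1 : RCLike.re ⟪P y, y⟫_ℂ = ‖CFC.sqrt P y‖ ^ 2 := by
      rw [← hsqrt y, hsa.inner_apply_left, inner_self_eq_norm_sq]
    rw [h1, ← apply_norm_sq_eq_inner_adjoint_left, comp_apply]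
    gcongr
    exact norm_adjoint_apply_le_of_isometry (adjoint_subtypeL_comp_subtypeL _) _
  · rw [adjoint_comp, adjoint_adjoint, comp_apply, comp_apply,
      subtypeL_adjoint_apply_of_mem _ hNx, hsa.adjoint_eq, hsqrt]

/-- Jensen's inequality for weighted sums on a finite-dimensional space. -/
lemma re_inner_cfc_sum_le_of_finiteDimensional {Q : Type u} [NormedAddCommGroup Q]
    [InnerProductSpace ℂ Q] [CompleteSpace Q] [FiniteDimensional ℂ Q]
    (ha : 0 < a) (hab : a < b) (hfc : ContinuousOn f (Set.Icc a b))
    (hconv : ∀ (E : Type u) [NormedAddCommGroup E] [InnerProductSpace ℂ E] [CompleteSpace E]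
      [FiniteDimensional ℂ E], finrank ℂ E ≤ Fintype.card ι → IsOperatorConvexOn E f)
    (hμ : ∀ i, μ i ∈ Set.Icc a b) (h₀ : μ i₀ = a) (h₁ : μ i₁ = b)
    (F : ι → Q →L[ℂ] Q) (hF : ∀ i, 0 ≤ F i) (hF1 : ∑ i, F i = 1) (x : Q) :
    RCLike.re ⟪cfc f (∑ i, μ i • F i) x, x⟫_ℂ ≤ ∑ i, f (μ i) * RCLike.re ⟪F i x, x⟫_ℂ := by
  have hcs : ∀ N : Submodule ℂ Q, CompleteSpace N := fun N => FiniteDimensional.complete ℂ N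
  have hsqrt : ∀ {P : Q →L[ℂ] Q}, 0 ≤ P → ∀ y, CFC.sqrt P (CFC.sqrt P y) = P y := by
    intro P hP y
    conv_rhs => rw [← CFC.sqrt_mul_sqrt_self P hP]
    rfl
  have hsa : ∀ P : Q →L[ℂ] Q, IsSelfAdjoint (CFC.sqrt P) := fun P =>
    .of_nonneg (CFC.sqrt_nonneg P)
  choose N hNc T hN hTF hTx using fun i => exists_finrank_le_one_le (hF i) x
  obtain ⟨G, hG0, hGint, hG1, hGμ, hGx⟩ := exists_weights_of_le hab hμ h₀ h₁ F
    (fun i => F i - adjoint (T i) ∘L T i) (fun i => sub_nonneg.2 (hTF i)) (fun i => by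
      rw [sub_le_self_iff, nonneg_iff_isPositive]
      exact isPositive_adjoint_comp_self _)
  have hGx' := hGx x fun i => by rw [sub_apply, comp_apply, hTx, sub_self]
  have hfactor : ∀ i, ∃ (M : Submodule ℂ Q) (S : Q →L[ℂ] M),
      (i ≠ i₀ → i ≠ i₁ → finrank ℂ M ≤ 1) ∧ adjoint S ∘L S = G i := by
    intro i
    by_cases hi : i ≠ i₀ ∧ i ≠ i₁
    · exact ⟨N i, T i, fun _ _ => hN i, by rw [hGint i hi.1 hi.2, sub_sub_cancel]⟩
    · refine ⟨⊤, adjoint (⊤ : Submodule ℂ Q).subtypeL ∘L CFC.sqrt (G i),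
        fun h h' => absurd ⟨h, h'⟩ hi, ?_⟩
      ext y
      rw [adjoint_comp, adjoint_adjoint, comp_apply, comp_apply, comp_apply,
        subtypeL_adjoint_apply_of_mem _ Submodule.mem_top, (hsa _).adjoint_eq, hsqrt (hG0 i)]
  choose M S hM hS using hfactor
  have key := cfc_sum_le_of_finrank_le_one ha hab hfc hconv hμ h₀ h₁ S
    (by simp only [hS, hG1, hF1]) hM
  simp only [hS, Complex.coe_smul, hGμ] at key
  refine (re_inner_le_of_le key x).trans (le_of_eq ?_)
  rw [sum_apply, sum_inner, map_sum]
  refine Finset.sum_congr rfl fun i _ => ?_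
  rw [smul_apply, hGx', inner_smul_left_eq_smul, RCLike.smul_re]

/-- On a Krylov subspace the powers of the compression agree with those of the operator. -/
lemma subtypeL_aeval_compress_krylov {E : Type*} [NormedAddCommGroup E] [InnerProductSpace ℂ E]
    [CompleteSpace E] (B : E →L[ℂ] E) (x : E) (p : Polynomial ℝ) (L : Submodule ℂ E)
    [CompleteSpace L] (hL : ∀ k ≤ p.natDegree, (B ^ k) x ∈ L) (x' : L) (hx' : (x' : E) = x) :
    ((p.aeval (compress L.subtypeL B) x' : L) : E) = p.aeval B x := by
  have hpow : ∀ k ≤ p.natDegree, (((compress L.subtypeL B) ^ k) x' : E) = (B ^ k) x := by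
    intro k
    induction k with
    | zero => intro _; simpa using hx'
    | succ k ih =>
      intro hk
      have h1 : L.subtypeL (((compress L.subtypeL B) ^ k) x') = (B ^ k) x := ih (by omega)
      have h2 := hL (k + 1) hk
      rw [pow_succ'] at h2 ⊢
      rw [pow_succ']
      change L.subtypeL (adjoint L.subtypeL (B (L.subtypeL (((compress L.subtypeL B) ^ k) x')))) = _
      rw [h1]
      exact subtypeL_adjoint_apply_of_mem L h2
  rw [Polynomial.aeval_eq_sum_range, Polynomial.aeval_eq_sum_range, sum_apply, sum_apply,
    Submodule.coe_sum]
  refine Finset.sum_congr rfl fun k hk => ?_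
  rw [smul_apply, smul_apply, ← hpow k (Nat.lt_succ_iff.1 (Finset.mem_range.1 hk))]
  rfl

lemma abs_re_inner_sub_le {E : Type*} [NormedAddCommGroup E] [InnerProductSpace ℂ E]
    [CompleteSpace E] {A B : E →L[ℂ] E} {ε : ℝ} (h : ‖A - B‖ ≤ ε) (x : E) :
    |RCLike.re ⟪A x, x⟫_ℂ - RCLike.re ⟪B x, x⟫_ℂ| ≤ ε * ‖x‖ ^ 2 := by
  rw [← map_sub, ← inner_sub_left, ← sub_apply]
  calc |RCLike.re ⟪(A - B) x, x⟫_ℂ| ≤ ‖⟪(A - B) x, x⟫_ℂ‖ := RCLike.abs_re_le_norm _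
    _ ≤ ‖(A - B) x‖ * ‖x‖ := norm_inner_le_norm _ _
    _ ≤ (ε * ‖x‖) * ‖x‖ := by gcongr; exact (A - B).le_of_opNorm_le h x
    _ = ε * ‖x‖ ^ 2 := by ring

lemma opBetween_sum_smul {E : Type*} [NormedAddCommGroup E] [InnerProductSpace ℂ E]
    [CompleteSpace E] (hμ : ∀ i, μ i ∈ Set.Icc a b) {F : ι → E →L[ℂ] E} (hF : ∀ i, 0 ≤ F i)
    (hF1 : ∑ i, F i = 1) : OpBetween a b (∑ i, μ i • F i) := by
  rw [OpBetween, Algebra.algebraMap_eq_smul_one, Algebra.algebraMap_eq_smul_one, ← hF1,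
    Finset.smul_sum, Finset.smul_sum]
  exact ⟨Finset.sum_le_sum fun i _ => smul_le_smul_of_nonneg_right (hμ i).1 (hF i),
    Finset.sum_le_sum fun i _ => smul_le_smul_of_nonneg_right (hμ i).2 (hF i)⟩

/-- Jensen's inequality for sums weighted by a finite positive operator-valued measure. -/
theorem cfc_sum_smul_le {H : Type u} [NormedAddCommGroup H] [InnerProductSpace ℂ H]
    [CompleteSpace H] (ha : 0 < a) (hab : a < b) (hfc : ContinuousOn f (Set.Icc a b))
    (hconv : ∀ (E : Type u) [NormedAddCommGroup E] [InnerProductSpace ℂ E] [CompleteSpace E]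
      [FiniteDimensional ℂ E], finrank ℂ E ≤ Fintype.card ι → IsOperatorConvexOn E f)
    (hμ : ∀ i, μ i ∈ Set.Icc a b) (h₀ : μ i₀ = a) (h₁ : μ i₁ = b)
    (F : ι → H →L[ℂ] H) (hF : ∀ i, 0 ≤ F i) (hF1 : ∑ i, F i = 1) :
    cfc f (∑ i, μ i • F i) ≤ ∑ i, f (μ i) • F i := by
  have hB := opBetween_sum_smul hμ hF hF1
  set B := ∑ i, μ i • F i with hBdef
  rw [opLE_iff (isSelfAdjoint_cfc_real f B) (isSelfAdjoint_sum _ fun i _ =>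
    (IsSelfAdjoint.all _).smul (.of_nonneg (hF i)))]
  intro x
  have hrhs : RCLike.re ⟪(∑ i, f (μ i) • F i) x, x⟫_ℂ =
      ∑ i, f (μ i) * RCLike.re ⟪F i x, x⟫_ℂ := by
    rw [sum_apply, sum_inner, map_sum]
    refine Finset.sum_congr rfl fun i _ => ?_
    rw [smul_apply, inner_smul_left_eq_smul, RCLike.smul_re]
  rw [hrhs]
  refine le_of_forall_pos_le_add fun ε hε => ?_
  obtain ⟨p, hp⟩ := exists_polynomial_near_of_continuousOn a b f hfc
    (ε / (2 * ‖x‖ ^ 2 + 1)) (by positivity)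
  set L : Submodule ℂ H := Submodule.span ℂ
    (Set.range fun k : Fin (p.natDegree + 1) => (B ^ (k : ℕ)) x) with hLdef
  have hLfin : FiniteDimensional ℂ L := FiniteDimensional.span_of_finite ℂ (Set.finite_range _)
  have : CompleteSpace L := FiniteDimensional.complete ℂ L
  have hLmem : ∀ k ≤ p.natDegree, (B ^ k) x ∈ L := fun k hk =>
    Submodule.subset_span ⟨⟨k, Nat.lt_succ_iff.2 hk⟩, rfl⟩
  have hiso := adjoint_subtypeL_comp_subtypeL L
  let x' : L := ⟨x, by simpa using hLmem 0 (Nat.zero_le _)⟩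
  have hBL : compress L.subtypeL B = ∑ i, μ i • compress L.subtypeL (F i) := by
    refine ContinuousLinearMap.ext fun y => ext_inner_right ℂ fun z => ?_
    rw [inner_compress, hBdef, sum_apply, sum_inner, sum_apply, sum_inner]
    refine Finset.sum_congr rfl fun i _ => ?_
    rw [smul_apply, smul_apply, inner_smul_left_eq_smul, inner_smul_left_eq_smul, inner_compress]
  have hF' : ∀ i, 0 ≤ compress L.subtypeL (F i) := fun i => by
    have h1 := compress_mono L.subtypeL (hF i)
    have h0 : compress L.subtypeL (0 : H →L[ℂ] H) = 0 := by ext; simp [compress]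
    rwa [h0] at h1
  have hF1' : ∑ i, compress L.subtypeL (F i) = 1 := by
    refine ContinuousLinearMap.ext fun y => ext_inner_right ℂ fun z => ?_
    rw [sum_apply, sum_inner]
    simp only [inner_compress]
    rw [← sum_inner, ← sum_apply, hF1]
    rfl
  have hJ := re_inner_cfc_sum_le_of_finiteDimensional ha hab hfc hconv hμ h₀ h₁
    (fun i => compress L.subtypeL (F i)) hF' hF1' x'
  rw [← hBL] at hJ
  simp only [inner_compress] at hJ
  have e1 := abs_re_inner_sub_le (norm_aeval_sub_cfc_le hfc hp (by positivity) hB) x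
  have e2 := abs_re_inner_sub_le (norm_aeval_sub_cfc_le hfc hp (by positivity)
    (hB.compress hiso)) x'
  have e3 : ⟪p.aeval (compress L.subtypeL B) x', x'⟫_ℂ = ⟪p.aeval B x, x⟫_ℂ := by
    rw [Submodule.coe_inner, subtypeL_aeval_compress_krylov B x p L hLmem x' rfl]
  have e4 : ‖x'‖ = ‖x‖ := rfl
  rw [e3, e4] at e2
  have e5 : ε / (2 * ‖x‖ ^ 2 + 1) * ‖x‖ ^ 2 * 2 ≤ ε := by
    have h6 : ε / (2 * ‖x‖ ^ 2 + 1) * ‖x‖ ^ 2 * 2 = ε * (2 * ‖x‖ ^ 2 / (2 * ‖x‖ ^ 2 + 1)) := by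
      ring
    rw [h6]
    refine mul_le_of_le_one_right hε.le ?_
    rw [div_le_one (by positivity)]
    linarith
  have e6 := (abs_le.1 e1).1
  have e7 := (abs_le.1 e2).2
  have hJ' : RCLike.re ⟪cfc f (compress L.subtypeL B) x', x'⟫_ℂ ≤
      ∑ i, f (μ i) * RCLike.re ⟪F i x, x⟫_ℂ := hJ
  linarith

end WeightedJensen

section ChoiDavis

open ContinuousLinearMap Module

variable {H : Type u} [NormedAddCommGroup H] [InnerProductSpace ℂ H] [CompleteSpace H]

/-- A self-adjoint operator with `n` points in its spectrum acts on a space containing `n`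
orthonormal vectors. -/
lemma exists_orthonormal_of_subset_spectrum {A : H →L[ℂ] H} (hA : IsSelfAdjoint A)
    {s : Finset ℝ} (hs : ∀ t ∈ s, t ∈ spectrum ℝ A) : ∃ v : s → H, Orthonormal ℂ v := by
  classical
  let T : s → Set ℝ := fun i => insert ((i : ℝ) + 1) ((s.erase i : Finset ℝ) : Set ℝ)
  let ψ : s → ℝ → ℝ := fun i t => max 0 (Metric.infDist t (T i) - |t - i|)
  have hψc : ∀ i, Continuous (ψ i) := fun i => by
    have := Metric.continuous_infDist_pt (T i)
    fun_prop
  have hψpos : ∀ i : s, ψ i i ≠ 0 := fun i => by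
    have hT : IsClosed (T i) := ((s.erase i).finite_toSet.insert _).isClosed
    have h1 : 0 < Metric.infDist (i : ℝ) (T i) :=
      (hT.notMem_iff_infDist_pos (Set.insert_nonempty _ _)).1 (by simp [T])
    simp only [ψ, sub_self, abs_zero, sub_zero]
    exact (lt_max_of_lt_right h1).ne'
  have hψmul : ∀ i j : s, i ≠ j → ∀ t, ψ i t * ψ j t = 0 := by
    have key : ∀ i j : s, i ≠ j → ∀ t, ψ i t ≠ 0 → |t - i| < |t - j| := by
      intro i j hij t h
      have h1 : 0 < Metric.infDist t (T i) - |t - i| := by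
        by_contra! h2
        exact h (max_eq_left h2)
      have h2 : Metric.infDist t (T i) ≤ |t - j| := by
        rw [← Real.dist_eq]
        refine Metric.infDist_le_dist_of_mem (Set.mem_insert_of_mem _ ?_)
        exact Finset.mem_coe.2 (Finset.mem_erase.2 ⟨fun h => hij (Subtype.ext h.symm), j.2⟩)
      linarith
    intro i j hij t
    by_contra h
    obtain ⟨hi, hj⟩ := mul_ne_zero_iff.1 h
    exact lt_asymm (key i j hij t hi) (key j i hij.symm t hj)
  have hne : ∀ i : s, ∃ x, cfc (ψ i) A x ≠ 0 := by
    intro i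
    by_contra! h
    have h0 : cfc (ψ i) A = 0 := ContinuousLinearMap.ext h
    have h1 : ψ i i ∈ spectrum ℝ (cfc (ψ i) A) := by
      rw [cfc_map_spectrum (ψ i) A hA (hψc i).continuousOn]
      exact ⟨i, hs i i.2, rfl⟩
    have : Nontrivial (H →L[ℂ] H) := by
      by_contra hn
      rw [not_nontrivial_iff_subsingleton] at hn
      exact absurd h1 (by simp [spectrum.of_subsingleton])
    rw [h0, spectrum.zero_eq] at h1
    exact hψpos i h1
  choose x hx using hne
  refine ⟨fun i => ((‖cfc (ψ i) A (x i)‖⁻¹ : ℝ) : ℂ) • cfc (ψ i) A (x i), ?_, ?_⟩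
  · intro i
    rw [norm_smul, Complex.norm_real, norm_inv, norm_norm,
      inv_mul_cancel₀ (norm_ne_zero_iff.2 (hx i))]
  · intro i j hij
    have h1 : cfc (ψ i) A * cfc (ψ j) A = 0 := by
      rw [← cfc_mul (ψ i) (ψ j) A (hψc i).continuousOn (hψc j).continuousOn]
      simp only [hψmul i j hij, cfc_const_zero]
    have h2 : ⟪cfc (ψ i) A (x i), cfc (ψ j) A (x j)⟫_ℂ = 0 := by
      rw [(isSelfAdjoint_cfc_real (ψ i) A).inner_apply_left]
      change ⟪x i, (cfc (ψ i) A * cfc (ψ j) A) (x j)⟫_ℂ = 0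
      rw [h1, zero_apply, inner_zero_right]
    simp only [inner_smul_left, inner_smul_right, h2, mul_zero]

/-- Operator convexity passes to spaces of dimension at most the number of spectral values of some
self-adjoint operator. -/
lemma IsOperatorConvexOn.of_finrank_le {f : ℝ → ℝ} (hfc : ContinuousOn f (Set.Ioi 0))
    (hf : IsOperatorConvexOn H f) {A : H →L[ℂ] H} (hA : IsSelfAdjoint A)
    {s : Finset ℝ} (hs : ∀ t ∈ s, t ∈ spectrum ℝ A) {E : Type*} [NormedAddCommGroup E]
    [InnerProductSpace ℂ E] [CompleteSpace E] [FiniteDimensional ℂ E]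
    (hE : finrank ℂ E ≤ Fintype.card s) : IsOperatorConvexOn E f := by
  obtain ⟨v, hv⟩ := exists_orthonormal_of_subset_spectrum hA hs
  obtain ⟨e⟩ : Nonempty (Fin (finrank ℂ E) ↪ s) :=
    Function.Embedding.nonempty_of_card_le (by simpa using hE)
  let β := stdOrthonormalBasis ℂ E
  let V : E →ₗᵢ[ℂ] H := (β.toBasis.constr ℂ (v ∘ e)).isometryOfOrthonormal
    (v := β.toBasis) (by simp) (by
      have : (β.toBasis.constr ℂ (v ∘ e)) ∘ β.toBasis = v ∘ e := by
        ext i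
        simp only [Function.comp_apply, Basis.constr_basis]
      rw [this]
      exact hv.comp e e.injective)
  exact hf.of_isometry hfc
    ((norm_map_iff_adjoint_comp_self V.toContinuousLinearMap).1 V.norm_map)

variable {Φ : (H →L[ℂ] H) →ₗ[ℂ] (H →L[ℂ] H)}

lemma IsUnitalPositiveMap.monotone (hΦ : IsUnitalPositiveMap Φ) {X Y : H →L[ℂ] H} (h : X ≤ Y) :
    Φ X ≤ Φ Y := by
  have := hΦ.2 (Y - X) (sub_nonneg.2 h)
  rwa [map_sub, sub_nonneg] at this

lemma map_real_smul_of_complexLinear {M N : Type*} [AddCommGroup M] [AddCommGroup N] [Module ℂ M]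
    [Module ℂ N] (Φ : M →ₗ[ℂ] N) (c : ℝ) (x : M) : Φ (c • x) = c • Φ x := by
  rw [← Complex.coe_smul, map_smul, Complex.coe_smul]

lemma IsUnitalPositiveMap.map_algebraMap {E : Type*} [NormedAddCommGroup E]
    [InnerProductSpace ℂ E] {Φ : (E →L[ℂ] E) →ₗ[ℂ] (E →L[ℂ] E)} (hΦ : IsUnitalPositiveMap Φ)
    (c : ℝ) : Φ (algebraMap ℝ (E →L[ℂ] E) c) = algebraMap ℝ (E →L[ℂ] E) c := by
  rw [Algebra.algebraMap_eq_smul_one, map_real_smul_of_complexLinear, hΦ.1]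

lemma IsUnitalPositiveMap.opBetween (hΦ : IsUnitalPositiveMap Φ) {a b : ℝ} {X : H →L[ℂ] H}
    (h : OpBetween a b X) : OpBetween a b (Φ X) := by
  have h1 := hΦ.monotone h.1
  have h2 := hΦ.monotone h.2
  rw [hΦ.map_algebraMap] at h1 h2
  exact ⟨h1, h2⟩

lemma OpBetween.norm_le {ε : ℝ} (hε : 0 ≤ ε) {X : H →L[ℂ] H} (h : OpBetween (-ε) ε X) :
    ‖X‖ ≤ ε := by
  rw [← cfc_id' ℝ X h.isSelfAdjoint]
  exact norm_cfc_le hε fun t ht => abs_le.2 (h.spectrum_subset ht)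

lemma IsUnitalPositiveMap.norm_map_cfc_le (hΦ : IsUnitalPositiveMap Φ) {A : H →L[ℂ] H}
    (hA : IsSelfAdjoint A) {k : ℝ → ℝ} (hk : ContinuousOn k (spectrum ℝ A)) {ε : ℝ} (hε : 0 ≤ ε)
    (h : ∀ t ∈ spectrum ℝ A, |k t| ≤ ε) : ‖Φ (cfc k A)‖ ≤ ε := by
  refine (hΦ.opBetween (opBetween_of_spectrum_subset (isSelfAdjoint_cfc_real k A) ?_)).norm_le hε
  rw [cfc_map_spectrum k A hA hk]
  rintro _ ⟨t, ht, rfl⟩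
  exact abs_le.1 (h t ht)

/-- A continuous partition of unity on a compact set of reals, subordinate to the balls of radius
`δ` around the points of a finite net. -/
lemma exists_partition_of_net {K : Set ℝ} {s : Finset ℝ} {δ : ℝ}
    (hnet : ∀ t ∈ K, ∃ i ∈ s, |t - i| < δ) :
    ∃ φ : s → ℝ → ℝ, (∀ i, ContinuousOn (φ i) K) ∧ (∀ i t, 0 ≤ φ i t) ∧
      (∀ t ∈ K, ∑ i, φ i t = 1) ∧
      ∀ (k : ℝ → ℝ) (ε : ℝ), (∀ t ∈ K, ∀ i ∈ s, |t - i| < δ → |k i - k t| ≤ ε) →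
        ∀ t ∈ K, |∑ i : s, k i * φ i t - k t| ≤ ε := by
  let η : s → ℝ → ℝ := fun i t => max 0 (δ - |t - i|)
  have hηc : ∀ i, Continuous (η i) := fun i => by fun_prop
  have hη0 : ∀ i t, 0 ≤ η i t := fun i t => le_max_left _ _
  have hηs : ∀ t, 0 ≤ ∑ j, η j t := fun t => Finset.sum_nonneg fun j _ => hη0 j t
  have hηpos : ∀ t ∈ K, 0 < ∑ j, η j t := fun t ht => by
    obtain ⟨i, hi, h⟩ := hnet t ht
    exact Finset.sum_pos' (fun j _ => hη0 j t)
      ⟨⟨i, hi⟩, Finset.mem_univ _, lt_max_of_lt_right (sub_pos.2 h)⟩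
  have hsum : ∀ t ∈ K, ∑ i, η i t / ∑ j, η j t = 1 := fun t ht => by
    rw [← Finset.sum_div, div_self (hηpos t ht).ne']
  refine ⟨fun i t => η i t / ∑ j, η j t, fun i => ?_, fun i t => div_nonneg (hη0 i t) (hηs t),
    hsum, ?_⟩
  · exact (hηc i).continuousOn.div (continuous_finsetSum _ fun j _ => hηc j).continuousOn
      fun t ht => (hηpos t ht).ne'
  · intro k ε hk t ht
    have h1 : ∑ i : s, k i * (η i t / ∑ j, η j t) - k t =
        ∑ i : s, (k i - k t) * (η i t / ∑ j, η j t) := by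
      simp only [sub_mul, Finset.sum_sub_distrib]
      rw [← Finset.mul_sum, hsum t ht, mul_one]
    rw [h1]
    calc |∑ i : s, (k i - k t) * (η i t / ∑ j, η j t)|
        ≤ ∑ i : s, |(k i - k t) * (η i t / ∑ j, η j t)| := Finset.abs_sum_le_sum_abs _ _
      _ ≤ ∑ i : s, ε * (η i t / ∑ j, η j t) := by
          refine Finset.sum_le_sum fun i _ => ?_
          rw [abs_mul, abs_of_nonneg (div_nonneg (hη0 i t) (hηs t))]
          by_cases h : |t - i| < δ
          · exact mul_le_mul_of_nonneg_right (hk t ht i i.2 h) (div_nonneg (hη0 i t) (hηs t))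
          · have : η i t = 0 := max_eq_left (by linarith)
            simp [this]
      _ = ε := by rw [← Finset.mul_sum, hsum t ht, mul_one]

/-- Discretization of the Choi–Davis inequality. -/
lemma IsUnitalPositiveMap.exists_cfc_le_near (hΦ : IsUnitalPositiveMap Φ) {f : ℝ → ℝ}
    (hfc : ContinuousOn f (Set.Ioi 0)) (hf : IsOperatorConvexOn H f) {A : H →L[ℂ] H}
    (hA : IsSelfAdjoint A) {a b : ℝ} (ha : 0 < a) (hab : a < b)
    (hspec : spectrum ℝ A ⊆ Set.Icc a b) (haA : a ∈ spectrum ℝ A) (hbA : b ∈ spectrum ℝ A)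
    {ε : ℝ} (hε : 0 < ε) :
    ∃ B C : H →L[ℂ] H, OpBetween a b B ∧ cfc f B ≤ C ∧ ‖B - Φ A‖ ≤ ε ∧
      ‖C - Φ (cfc f A)‖ ≤ ε := by
  classical
  have hfab : ContinuousOn f (Set.Icc a b) := hfc.mono fun t ht => ha.trans_le ht.1
  have hfA : ContinuousOn f (spectrum ℝ A) := hfab.mono hspec
  have hK : IsCompact (spectrum ℝ A) := ContinuousFunctionalCalculus.isCompact_spectrum A
  obtain ⟨δ₀, hδ₀, hunif⟩ := Metric.uniformContinuousOn_iff_le.1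
    (hK.uniformContinuousOn_of_continuous hfA) ε hε
  set δ := min δ₀ ε with hδ
  have hδpos : 0 < δ := lt_min hδ₀ hε
  obtain ⟨s₀, hs₀, hcov⟩ := hK.elim_nhds_subcover (fun t => Metric.ball t δ)
    fun t _ => Metric.ball_mem_nhds t hδpos
  set s : Finset ℝ := insert a (insert b s₀) with hs
  have hsK : ∀ t ∈ s, t ∈ spectrum ℝ A := fun t ht => by
    rcases Finset.mem_insert.1 ht with rfl | ht
    · exact haA
    rcases Finset.mem_insert.1 ht with rfl | ht
    · exact hbA
    exact hs₀ t ht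
  obtain ⟨φ, hφc, hφ0, hφ1, hφ⟩ := exists_partition_of_net (K := spectrum ℝ A) (s := s) (δ := δ)
    fun t ht => by
      obtain ⟨i, hi, h⟩ := Set.mem_iUnion₂.1 (hcov ht)
      exact ⟨i, by simp [hs, hi], by rwa [← Real.dist_eq]⟩
  have hΦsum : ∀ k : ℝ → ℝ, ∑ i : s, k i • Φ (cfc (φ i) A) =
      Φ (cfc (fun t => ∑ i : s, k i * φ i t) A) := fun k => by
    rw [← Finset.sum_fn, cfc_sum_univ _ A fun i => (hφc i).const_mul _, map_sum]
    refine Finset.sum_congr rfl fun i _ => ?_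
    rw [cfc_const_mul _ _ A (hφc i), map_real_smul_of_complexLinear]
  have happrox : ∀ k : ℝ → ℝ, ContinuousOn k (spectrum ℝ A) →
      (∀ t ∈ spectrum ℝ A, ∀ i ∈ s, |t - i| < δ → |k i - k t| ≤ ε) →
      ‖∑ i : s, k i • Φ (cfc (φ i) A) - Φ (cfc k A)‖ ≤ ε := fun k hk h => by
    have hc : ContinuousOn (fun t => ∑ i : s, k i * φ i t) (spectrum ℝ A) :=
      continuousOn_finsetSum _ fun i _ => (hφc i).const_mul _
    rw [hΦsum, ← map_sub, ← cfc_sub _ _ A hc hk]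
    exact hΦ.norm_map_cfc_le hA (hc.sub hk) hε.le (hφ k ε h)
  have hF0 : ∀ i, 0 ≤ Φ (cfc (φ i) A) := fun i =>
    hΦ.2 _ (cfc_nonneg fun t _ => hφ0 i t)
  have hF1 : ∑ i, Φ (cfc (φ i) A) = 1 := by
    have h1 := hΦsum fun _ => 1
    simp only [one_smul, one_mul] at h1
    rw [h1, cfc_congr (g := fun _ => 1) fun t ht => hφ1 t ht, cfc_const_one ℝ A hA, hΦ.1]
  have hμ : ∀ i : s, (i : ℝ) ∈ Set.Icc a b := fun i => hspec (hsK i i.2)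
  refine ⟨∑ i : s, (i : ℝ) • Φ (cfc (φ i) A), ∑ i : s, f i • Φ (cfc (φ i) A),
    opBetween_sum_smul hμ hF0 hF1, ?_, ?_, ?_⟩
  · exact cfc_sum_smul_le (i₀ := ⟨a, by simp [hs]⟩) (i₁ := ⟨b, by simp [hs]⟩) ha hab hfab
      (fun E _ _ _ _ hE => hf.of_finrank_le hfc hA hsK hE) hμ rfl rfl _ hF0 hF1
  · have h1 := happrox (fun t => t) continuousOn_id fun t _ i _ h => by
      rw [abs_sub_comm]
      exact h.le.trans (min_le_right _ _)
    rwa [cfc_id' ℝ A hA] at h1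
  · refine happrox f hfA fun t ht i hi h => ?_
    rw [abs_sub_comm, ← Real.dist_eq]
    exact hunif t ht i (hsK i hi) (by rw [Real.dist_eq]; exact h.le.trans (min_le_left _ _))

/-- The **Choi–Davis inequality** for positive unital maps on `B(H)`. -/
theorem IsUnitalPositiveMap.cfc_map_le (hΦ : IsUnitalPositiveMap Φ) {f : ℝ → ℝ}
    (hfc : ContinuousOn f (Set.Ioi 0)) (hf : IsOperatorConvexOn H f) {A : H →L[ℂ] H}
    (hA : 0 ≤ A) (hAu : IsUnit A) : cfc f (Φ A) ≤ Φ (cfc f A) := by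
  rcases subsingleton_or_nontrivial (H →L[ℂ] H) with hH | hH
  · exact (Subsingleton.elim _ _).le
  have hsa : IsSelfAdjoint A := .of_nonneg hA
  have hK : IsCompact (spectrum ℝ A) := ContinuousFunctionalCalculus.isCompact_spectrum A
  have hKn : (spectrum ℝ A).Nonempty := ContinuousFunctionalCalculus.spectrum_nonempty A hsa
  obtain ⟨a, haA, hmin⟩ := hK.exists_isLeast hKn
  obtain ⟨b, hbA, hmax⟩ := hK.exists_isGreatest hKn
  have hspec : spectrum ℝ A ⊆ Set.Icc a b := fun t ht => ⟨hmin ht, hmax ht⟩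
  have ha : 0 < a := by
    obtain ⟨c, d, hc, hcd⟩ := exists_opBetween hA hAu
    exact hc.trans_le (hcd.spectrum_subset haA).1
  rcases (hspec haA).2.eq_or_lt with rfl | hab
  · have h1 : A = algebraMap ℝ _ a := by
      have := opBetween_of_spectrum_subset hsa hspec
      exact le_antisymm this.2 this.1
    rw [h1, hΦ.map_algebraMap, cfc_algebraMap, hΦ.map_algebraMap]
  · choose B C hB hBC hBn hCn using fun n : ℕ => hΦ.exists_cfc_le_near hfc hf hsa ha hab hspec haA
      hbA (Nat.one_div_pos_of_nat (α := ℝ) (n := n))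
    have hΦA := hΦ.opBetween (opBetween_of_spectrum_subset hsa hspec)
    have hlim := tendsto_one_div_add_atTop_nhds_zero_nat (𝕜 := ℝ)
    have hBlim : Filter.Tendsto B Filter.atTop (nhds (Φ A)) :=
      tendsto_iff_norm_sub_tendsto_zero.2 (squeeze_zero (fun _ => norm_nonneg _) hBn hlim)
    have hClim : Filter.Tendsto C Filter.atTop (nhds (Φ (cfc f A))) :=
      tendsto_iff_norm_sub_tendsto_zero.2 (squeeze_zero (fun _ => norm_nonneg _) hCn hlim)
    have hcont := continuousOn_cfc (H →L[ℂ] H) (isCompact_Icc (a := a) (b := b)) f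
      (hfc.mono fun t ht => ha.trans_le ht.1)
    have hcfc : Filter.Tendsto (fun n => cfc f (B n)) Filter.atTop (nhds (cfc f (Φ A))) :=
      (hcont (Φ A) ⟨hΦA.isSelfAdjoint, hΦA.spectrum_subset⟩).tendsto.comp
        (tendsto_nhdsWithin_iff.2 ⟨hBlim, .of_forall fun n =>
          ⟨(hB n).isSelfAdjoint, (hB n).spectrum_subset⟩⟩)
    exact le_of_tendsto_of_tendsto' hcfc hClim hBC

end ChoiDavis

section RpowInequalities

variable {H : Type u} [NormedAddCommGroup H] [InnerProductSpace ℂ H] [CompleteSpace H]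

lemma IsStrictlyPositive.ringInverse_rpow {X : H →L[ℂ] H} (hX : IsStrictlyPositive X) (p : ℝ) :
    Ring.inverse (X ^ p) = X ^ (-p) :=
  Ring.inverse_unit ⟨X ^ p, X ^ (-p), CFC.rpow_mul_rpow_neg p hX, CFC.rpow_neg_mul_rpow p hX⟩

lemma IsStrictlyPositive.rpow_neg_le_rpow_neg {X Y : H →L[ℂ] H} (hX : IsStrictlyPositive X)
    (h : X ≤ Y) {p : ℝ} (hp : p ∈ Set.Icc (0 : ℝ) 1) : Y ^ (-p) ≤ X ^ (-p) := by
  have hY : IsStrictlyPositive Y := hX.of_le h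
  rw [← hX.ringInverse_rpow, ← hY.ringInverse_rpow]
  exact CStarAlgebra.antitoneOn_ringInverse (IsStrictlyPositive.rpow X p hX)
    (IsStrictlyPositive.rpow Y p hY) (CFC.rpow_le_rpow hp h)

lemma isOperatorConvexOn_rpow_neg {p : ℝ} (hp : p ∈ Set.Icc (0 : ℝ) 1) :
    IsOperatorConvexOn H fun t => t ^ (-p) := by
  intro A B hA hAu hB hBu c hc
  have hA' := hAu.isStrictlyPositive hA
  have hB' := hBu.isStrictlyPositive hB
  have hc' : 0 ≤ 1 - c := sub_nonneg.2 hc.2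
  have hAr := IsStrictlyPositive.rpow A p hA'
  have hBr := IsStrictlyPositive.rpow B p hB'
  have hconv := CStarAlgebra.convexOn_ringInverse (A := H →L[ℂ] H)
  have hC : IsStrictlyPositive (c • A + (1 - c) • B) :=
    hconv.1 hA' hB' hc.1 hc' (add_sub_cancel _ _)
  have hCr : IsStrictlyPositive (c • A ^ p + (1 - c) • B ^ p) :=
    hconv.1 hAr hBr hc.1 hc' (add_sub_cancel _ _)
  rw [← CFC.rpow_eq_cfc_real hA, ← CFC.rpow_eq_cfc_real hB, ← CFC.rpow_eq_cfc_real hC.nonneg,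
    ← hA'.ringInverse_rpow, ← hB'.ringInverse_rpow, ← hC.ringInverse_rpow]
  refine le_trans (CStarAlgebra.antitoneOn_ringInverse hCr (IsStrictlyPositive.rpow _ p hC) ?_)
    (hconv.2 hAr hBr hc.1 hc' (add_sub_cancel _ _))
  exact (CFC.concaveOn_rpow hp).2 hA hB hc.1 hc' (add_sub_cancel _ _)

lemma IsStrictlyPositive.cfc_of_pos {X : H →L[ℂ] H} (hX : IsStrictlyPositive X) {f : ℝ → ℝ}
    (hfc : ContinuousOn f (Set.Ioi 0)) (hf : ∀ t ∈ Set.Ioi (0 : ℝ), 0 < f t) :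
    IsStrictlyPositive (cfc f X) := by
  have hspec : ∀ t ∈ spectrum ℝ X, t ∈ Set.Ioi (0 : ℝ) := fun t ht => hX.spectrum_pos ht
  refine IsUnit.isStrictlyPositive ?_ (cfc_nonneg fun t ht => (hf t (hspec t ht)).le)
  rw [isUnit_cfc_iff f X (hfc.mono hspec) hX.isSelfAdjoint]
  exact fun t ht => (hf t (hspec t ht)).ne'

lemma IsStrictlyPositive.rpow_cfc {X : H →L[ℂ] H} (hX : IsStrictlyPositive X) {f : ℝ → ℝ}
    (hfc : ContinuousOn f (Set.Ioi 0)) (hf : ∀ t ∈ Set.Ioi (0 : ℝ), 0 < f t) (p : ℝ) :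
    cfc f X ^ p = cfc (fun t => f t ^ p) X := by
  have hspec : ∀ t ∈ spectrum ℝ X, t ∈ Set.Ioi (0 : ℝ) := fun t ht => hX.spectrum_pos ht
  rw [CFC.rpow_eq_cfc_real (hX.cfc_of_pos hfc hf).nonneg,
    ← cfc_comp' (fun t => t ^ p) f X ?_ (hfc.mono hspec) hX.isSelfAdjoint]
  rintro _ ⟨t, ht, rfl⟩
  exact (Real.continuousAt_rpow_const _ _ (Or.inl (hf t (hspec t ht)).ne')).continuousWithinAt

lemma IsStrictlyPositive.rpow_neg_mul_rpow_mul_rpow_neg {X : H →L[ℂ] H}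
    (hX : IsStrictlyPositive X) {f g : ℝ → ℝ}
    (hfc : ContinuousOn f (Set.Ioi 0)) (hgc : ContinuousOn g (Set.Ioi 0))
    (hf : ∀ t ∈ Set.Ioi (0 : ℝ), 0 < f t) (hg : ∀ t ∈ Set.Ioi (0 : ℝ), 0 < g t) (r : ℝ) :
    cfc f X ^ (-r) * X ^ r * cfc g X ^ (-r) = cfc (fun t => f t * g t / t) X ^ (-r) := by
  have hspec : ∀ t ∈ spectrum ℝ X, t ∈ Set.Ioi (0 : ℝ) := fun t ht => hX.spectrum_pos ht
  have hc : ∀ {k : ℝ → ℝ}, ContinuousOn k (Set.Ioi 0) → (∀ t ∈ Set.Ioi (0 : ℝ), 0 < k t) →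
      ∀ p : ℝ, ContinuousOn (fun t => k t ^ p) (spectrum ℝ X) := fun hk hk0 p =>
    (hk.mono hspec).rpow_const fun t ht => Or.inl (hk0 t (hspec t ht)).ne'
  have hid : ContinuousOn (fun t : ℝ => t ^ r) (spectrum ℝ X) :=
    hc (k := fun t => t) continuousOn_id (fun t ht => ht) r
  rw [hX.rpow_cfc hfc hf, hX.rpow_cfc hgc hg, CFC.rpow_eq_cfc_real hX.nonneg,
    hX.rpow_cfc (f := fun t => f t * g t / t)
      ((hfc.mul hgc).div continuousOn_id fun t ht => ne_of_gt ht)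
      fun t ht => div_pos (mul_pos (hf t ht) (hg t ht)) ht,
    ← cfc_mul _ _ X (hc hfc hf _) hid,
    ← cfc_mul (fun t => f t ^ (-r) * t ^ r) _ X ((hc hfc hf _).mul hid) (hc hgc hg _)]
  refine cfc_congr fun t ht => ?_
  have h1 := hf t (hspec t ht)
  have h2 := hg t (hspec t ht)
  have h3 : 0 < t := hspec t ht
  rw [Real.div_rpow (mul_pos h1 h2).le h3.le, Real.mul_rpow h1.le h2.le, Real.rpow_neg h3.le,
    div_inv_eq_mul]
  ring

lemma star_rpow (X : H →L[ℂ] H) (p : ℝ) : star (X ^ p) = X ^ p :=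
  (IsSelfAdjoint.of_nonneg CFC.rpow_nonneg).star_eq

/-- Polar decomposition of an invertible operator, relating `|Z|` and `|Z*|`. -/
lemma exists_star_mul_self_eq_one_of_isUnit {Z : H →L[ℂ] H} (hZ : IsUnit Z) :
    ∃ U : H →L[ℂ] H, star U * U = 1 ∧ opAbs Z = star U * CFC.sqrt (Z * star Z) * U := by
  obtain ⟨P, hP, hPP, hPZ⟩ : ∃ P, IsStrictlyPositive P ∧ P * P = star Z * Z ∧ opAbs Z = P :=
    ⟨CFC.sqrt (star Z * Z), IsStrictlyPositive.sqrt _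
      ((hZ.star.mul hZ).isStrictlyPositive (star_mul_self_nonneg Z)),
      CFC.sqrt_mul_sqrt_self _ (star_mul_self_nonneg Z), rfl⟩
  obtain ⟨Q, hQ, hPQ, hQP⟩ : ∃ Q : H →L[ℂ] H, star Q = Q ∧ P * Q = 1 ∧ Q * P = 1 := by
    refine ⟨P ^ (-1 : ℝ), star_rpow P _, ?_, ?_⟩
    · simpa only [CFC.rpow_one P hP.nonneg] using CFC.rpow_mul_rpow_neg 1 hP
    · simpa only [CFC.rpow_one P hP.nonneg] using CFC.rpow_neg_mul_rpow 1 hP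
  obtain ⟨U, hUU, hUP⟩ : ∃ U : H →L[ℂ] H, star U * U = 1 ∧ U * P = Z := by
    refine ⟨Z * Q, ?_, by rw [mul_assoc, hQP, mul_one]⟩
    calc star (Z * Q) * (Z * Q) = Q * (star Z * Z) * Q := by
          rw [star_mul, hQ]; simp only [mul_assoc]
      _ = (Q * P) * (P * Q) := by rw [← hPP]; simp only [mul_assoc]
      _ = 1 := by rw [hQP, hPQ, mul_one]
  refine ⟨U, hUU, ?_⟩
  have hsqrt : CFC.sqrt (Z * star Z) = U * P * star U := by
    refine CFC.sqrt_unique ?_ (star_right_conjugate_nonneg hP.nonneg U)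
    calc U * P * star U * (U * P * star U)
        = U * P * (star U * U) * (P * star U) := by simp only [mul_assoc]
      _ = U * P * star (U * P) := by rw [hUU, mul_one, star_mul, hP.isSelfAdjoint.star_eq]
      _ = Z * star Z := by rw [hUP]
  calc opAbs Z = (star U * U) * P * (star U * U) := by rw [hUU, mul_one, one_mul, hPZ]
    _ = star U * CFC.sqrt (Z * star Z) * U := by rw [hsqrt]; simp only [mul_assoc]

/-- Increasing the outer factors decreases `|F^(-r) M^r G^(-r)|` up to a unitary. -/
lemma exists_opAbs_rpow_mul_le {F F₀ G G₀ M : H →L[ℂ] H} {r : ℝ} (hr0 : 0 ≤ r) (hr1 : r ≤ 1 / 2)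
    (hF₀ : IsStrictlyPositive F₀) (hG₀ : IsStrictlyPositive G₀) (hM : IsStrictlyPositive M)
    (hF : F₀ ≤ F) (hG : G₀ ≤ G) (hK : 0 ≤ F₀ ^ (-r) * M ^ r * G₀ ^ (-r)) :
    ∃ U : H →L[ℂ] H, star U * U = 1 ∧
      opAbs (F ^ (-r) * M ^ r * G ^ (-r)) ≤ star U * (F₀ ^ (-r) * M ^ r * G₀ ^ (-r)) * U := by
  have hsq : ∀ {X Y : H →L[ℂ] H}, IsStrictlyPositive X → X ≤ Y →
      Y ^ (-r) * Y ^ (-r) ≤ X ^ (-r) * X ^ (-r) := fun {X Y} hX h => by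
    rw [← CFC.rpow_add hX.isUnit, ← CFC.rpow_add (hX.of_le h).isUnit, ← neg_add]
    exact hX.rpow_neg_le_rpow_neg h ⟨by linarith, by linarith⟩
  have hGp : IsStrictlyPositive G := hG₀.of_le hG
  have hZ : IsUnit (F₀ ^ (-r) * M ^ r * G ^ (-r)) :=
    ((hF₀.isUnit.cfcRpow _ hF₀.nonneg).mul (hM.isUnit.cfcRpow _ hM.nonneg)).mul
      (hGp.isUnit.cfcRpow _ hGp.nonneg)
  obtain ⟨U, hU, hUZ⟩ := exists_star_mul_self_eq_one_of_isUnit hZ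
  refine ⟨U, hU, ?_⟩
  have h1 : opAbs (F ^ (-r) * M ^ r * G ^ (-r)) ≤ opAbs (F₀ ^ (-r) * M ^ r * G ^ (-r)) := by
    have := star_left_conjugate_le_conjugate (hsq hF₀ hF) (M ^ r * G ^ (-r))
    refine CFC.sqrt_le_sqrt _ _ ?_
    simpa only [star_mul, star_rpow, mul_assoc] using this
  have h2 : CFC.sqrt (F₀ ^ (-r) * M ^ r * G ^ (-r) * star (F₀ ^ (-r) * M ^ r * G ^ (-r))) ≤
      F₀ ^ (-r) * M ^ r * G₀ ^ (-r) := by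
    rw [← CFC.sqrt_mul_self (F₀ ^ (-r) * M ^ r * G₀ ^ (-r)) hK]
    refine CFC.sqrt_le_sqrt _ _ ?_
    have h3 : F₀ ^ (-r) * M ^ r * G₀ ^ (-r) * (F₀ ^ (-r) * M ^ r * G₀ ^ (-r)) =
        F₀ ^ (-r) * M ^ r * G₀ ^ (-r) * star (F₀ ^ (-r) * M ^ r * G₀ ^ (-r)) := by
      rw [(IsSelfAdjoint.of_nonneg hK).star_eq]
    rw [h3]
    have := star_right_conjugate_le_conjugate (hsq hG₀ hG) (F₀ ^ (-r) * M ^ r)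
    simpa only [star_mul, star_rpow, mul_assoc] using this
  exact h1.trans (hUZ.trans_le (star_left_conjugate_le_conjugate h2 U))

lemma IsUnitalPositiveMap.isStrictlyPositive {Φ : (H →L[ℂ] H) →ₗ[ℂ] (H →L[ℂ] H)}
    (hΦ : IsUnitalPositiveMap Φ) {X : H →L[ℂ] H} (hX : IsStrictlyPositive X) :
    IsStrictlyPositive (Φ X) := by
  obtain ⟨a, b, ha, hab⟩ := exists_opBetween hX.nonneg hX.isUnit
  have h := hΦ.opBetween hab
  exact (h.isUnit ha).isStrictlyPositive (h.nonneg ha)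

end RpowInequalities

/-- **Theorem 2.2 (asymmetric Choi–Davis inequality).** If `Φ` is a unital positive linear map,
`0 ≤ r ≤ 1/2`, and `f, g : (0,∞) → (0,∞)` are operator convex functions such that
`t ↦ f(t)g(t)/t` is operator concave, then for every positive invertible `A` there is a partial
isometry `V` with `|Φ(f(A))^(-r) Φ(A)^r Φ(g(A))^(-r)| ≤ V* Φ(f(A)^(-r) A^r g(A)^(-r)) V`. -/
theorem asymmetric_choi_davis_rpow_convex
    (Φ : (H →L[ℂ] H) →ₗ[ℂ] (H →L[ℂ] H)) (hΦ : IsUnitalPositiveMap Φ)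
    (r : ℝ) (hr0 : 0 ≤ r) (hr1 : r ≤ 1 / 2)
    (f g : ℝ → ℝ)
    (hfc : ContinuousOn f (Set.Ioi 0)) (hgc : ContinuousOn g (Set.Ioi 0))
    (hfpos : ∀ t ∈ Set.Ioi (0 : ℝ), 0 < f t) (hgpos : ∀ t ∈ Set.Ioi (0 : ℝ), 0 < g t)
    (hf : IsOperatorConvexOn H f) (hg : IsOperatorConvexOn H g)
    (hfg : IsOperatorConcaveOn H (fun t => f t * g t / t))
    (A : H →L[ℂ] H) (hA : 0 ≤ A) (hAu : IsUnit A) :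
    ∃ V : H →L[ℂ] H, V * star V * V = V ∧
      opAbs (CFC.rpow (Φ (cfc f A)) (-r) * CFC.rpow (Φ A) r * CFC.rpow (Φ (cfc g A)) (-r)) ≤
        star V * Φ (CFC.rpow (cfc f A) (-r) * CFC.rpow A r * CFC.rpow (cfc g A) (-r)) * V := by
  simp only [CFC.rpow_eq_pow]
  have hAp : IsStrictlyPositive A := hAu.isStrictlyPositive hA
  have hMp : IsStrictlyPositive (Φ A) := hΦ.isStrictlyPositive hAp
  have hhc : ContinuousOn (fun t => f t * g t / t) (Set.Ioi 0) :=
    (hfc.mul hgc).div continuousOn_id fun t ht => ne_of_gt ht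
  have hhpos : ∀ t ∈ Set.Ioi (0 : ℝ), 0 < f t * g t / t := fun t ht =>
    div_pos (mul_pos (hfpos t ht) (hgpos t ht)) ht
  have hhA := hAp.cfc_of_pos hhc hhpos
  have hr : r ∈ Set.Icc (0 : ℝ) 1 := ⟨hr0, by linarith⟩
  have hM := hMp.rpow_neg_mul_rpow_mul_rpow_neg hfc hgc hfpos hgpos r
  obtain ⟨U, hU, hle⟩ := exists_opAbs_rpow_mul_le hr0 hr1 (hMp.cfc_of_pos hfc hfpos)
    (hMp.cfc_of_pos hgc hgpos) hMp (hΦ.cfc_map_le hfc hf hA hAu) (hΦ.cfc_map_le hgc hg hA hAu)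
    (hM ▸ CFC.rpow_nonneg)
  refine ⟨U, by rw [mul_assoc, hU, mul_one], hle.trans (star_left_conjugate_le_conjugate ?_ U)⟩
  rw [hM, hAp.rpow_neg_mul_rpow_mul_rpow_neg hfc hgc hfpos hgpos r]
  have h1 : Φ (cfc (fun t => f t * g t / t) A) ≤ cfc (fun t => f t * g t / t) (Φ A) := by
    have := hΦ.cfc_map_le (f := fun t => -(f t * g t / t)) hhc.neg hfg hA hAu
    rwa [cfc_neg, cfc_neg, map_neg, neg_le_neg_iff] at this
  refine ((hΦ.isStrictlyPositive hhA).rpow_neg_le_rpow_neg h1 hr).trans ?_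
  have hpow : ContinuousOn (fun t : ℝ => t ^ (-r)) (Set.Ioi 0) :=
    continuousOn_id.rpow_const fun t ht => Or.inl (ne_of_gt ht)
  have h2 := hΦ.cfc_map_le hpow (isOperatorConvexOn_rpow_neg hr) hhA.nonneg hhA.isUnit
  rwa [← CFC.rpow_eq_cfc_real hhA.nonneg,
    ← CFC.rpow_eq_cfc_real (hΦ.isStrictlyPositive hhA).nonneg] at h2
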